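/- arXiv:1609.01938 — 3 statements merged into one kernel-verified Lean document; each statement's English description precedes it below -/
import Mathlib

section
/- Let d ≥ 3 be an integer, σ > 0 and s > 0 with d + s − 2σ > 0 and σ < d. Set r₁ = max(1, d/(d+s−σ)) and r₂ = d/σ. Let r₁ < p < r₂ and let w be a weight on ℝ^d belonging to A_{p/r₁} ∩ RH_{(r₂/p)'}, where (r₂/p)' is the conjugate exponent of r₂/p. Then there exists a constant C > 0 such that for all measurable f : ℝ^d → ℂ, ( ∫_{ℝ^d} ( ∫_{ℝ^d} |f(y)| / ( (|x|+|y|)^{d+s−2σ} |x|^σ |y|^σ ) dy )^p w(x) dx )^{1/p} ≤ C ( ∫_{ℝ^d} ( |f(x)| / |x|^s )^p w(x) dx )^{1/p}. -/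
open MeasureTheory Metric Real
open scoped ENNReal

/-- The average `⨍_B g` of a (nonnegative) function over a set, as an extended real. -/
noncomputable def ballAvg {d : ℕ} (B : Set (EuclideanSpace ℝ (Fin d)))
    (g : EuclideanSpace ℝ (Fin d) → ℝ) : ℝ≥0∞ :=
  (∫⁻ x in B, ENNReal.ofReal (g x)) / MeasureTheory.volume B

/-- The Muckenhoupt class `A_q` (for `1 < q < ∞`):  `w` is a nonnegative locally integrable
function with `(⨍_B w) (⨍_B w^{-1/(q-1)})^{q-1} ≤ C` for all balls `B`. -/
def IsMuckenhoupt (d : ℕ) (q : ℝ) (w : EuclideanSpace ℝ (Fin d) → ℝ) : Prop :=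
  (∀ x, 0 ≤ w x) ∧ MeasureTheory.LocallyIntegrable w ∧
    ∃ C : ℝ, 0 < C ∧ ∀ (c : EuclideanSpace ℝ (Fin d)) (r : ℝ), 0 < r →
      ballAvg (Metric.ball c r) w *
          (ballAvg (Metric.ball c r) fun x => w x ^ (-1 / (q - 1))) ^ (q - 1) ≤
        ENNReal.ofReal C

/-- The reverse Hölder class `RH_r` (for `1 < r < ∞`): `w` is a nonnegative locally integrable
function with `(⨍_B w^r)^{1/r} ≤ C ⨍_B w` for all balls `B`. -/
def IsReverseHolder (d : ℕ) (r : ℝ) (w : EuclideanSpace ℝ (Fin d) → ℝ) : Prop :=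
  (∀ x, 0 ≤ w x) ∧ MeasureTheory.LocallyIntegrable w ∧
    ∃ C : ℝ, 0 < C ∧ ∀ (c : EuclideanSpace ℝ (Fin d)) (ρ : ℝ), 0 < ρ →
      (ballAvg (Metric.ball c ρ) fun x => w x ^ r) ^ (1 / r) ≤
        ENNReal.ofReal C * ballAvg (Metric.ball c ρ) w

/-- Schur's test on `ℓ^p(ℤ)`. -/
theorem tsum_rpow_le_of_schur {a : ℤ → ℤ → ℝ≥0∞} {M : ℝ≥0∞} {p : ℝ} (hp : 1 < p)
    (hrow : ∀ j, ∑' k, a j k ≤ M) (hcol : ∀ k, ∑' j, a j k ≤ M) (b : ℤ → ℝ≥0∞) :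
    ∑' j, (∑' k, a j k * b k) ^ p ≤ M ^ p * ∑' k, b k ^ p := by
  have hp0 : 0 < p := by linarith
  have hp1 : 1 / p ≤ 1 := by rw [div_le_one hp0]; exact hp.le
  have hp2 : 0 ≤ 1 - 1 / p := by linarith
  have key : ∀ j, (∑' k, a j k * b k) ^ p ≤ M ^ (p - 1) * ∑' k, a j k * b k ^ p := by
    intro j
    have h := ENNReal.lintegral_mul_norm_pow_le (μ := (Measure.count : Measure ℤ))
      (f := fun k => a j k * b k ^ p) (g := fun k => a j k)
      Measurable.of_discrete.aemeasurable Measurable.of_discrete.aemeasurable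
      (p := 1 / p) (q := 1 - 1 / p) (by positivity) hp2 (by ring)
    simp only [lintegral_count] at h
    have e : ∀ k, (a j k * b k ^ p) ^ (1 / p) * a j k ^ (1 - 1 / p) = a j k * b k := by
      intro k
      rw [ENNReal.mul_rpow_of_nonneg _ _ (by positivity), ← ENNReal.rpow_mul,
        mul_one_div_cancel hp0.ne', ENNReal.rpow_one, mul_right_comm,
        ← ENNReal.rpow_add_of_nonneg _ _ (by positivity) hp2]
      simp
    simp only [e] at h
    calc (∑' k, a j k * b k) ^ p
        ≤ ((∑' k, a j k * b k ^ p) ^ (1 / p) * (∑' k, a j k) ^ (1 - 1 / p)) ^ p := by gcongr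
      _ = (∑' k, a j k) ^ (p - 1) * ∑' k, a j k * b k ^ p := by
        rw [ENNReal.mul_rpow_of_nonneg _ _ hp0.le, ← ENNReal.rpow_mul, ← ENNReal.rpow_mul,
          one_div_mul_cancel hp0.ne', ENNReal.rpow_one, mul_comm]
        congr 2
        field_simp
      _ ≤ _ := by
        gcongr
        · exact hrow j
  calc ∑' j, (∑' k, a j k * b k) ^ p
      ≤ ∑' j, M ^ (p - 1) * ∑' k, a j k * b k ^ p := ENNReal.tsum_le_tsum key
    _ = M ^ (p - 1) * ∑' k, (∑' j, a j k) * b k ^ p := by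
      rw [ENNReal.tsum_mul_left, ENNReal.tsum_comm]
      simp_rw [ENNReal.tsum_mul_right]
    _ ≤ M ^ (p - 1) * ∑' k, M * b k ^ p := by
      gcongr with k
      exact hcol k
    _ = M ^ p * ∑' k, b k ^ p := by
      rw [ENNReal.tsum_mul_left, ← mul_assoc]
      congr 1
      nth_rw 2 [← ENNReal.rpow_one M]
      rw [← ENNReal.rpow_add_of_nonneg _ _ (by linarith) zero_le_one]
      simp

theorem lintegral_rpow_le_log_convex {α : Type*} [MeasurableSpace α] {μ : Measure α} {W : α → ℝ≥0∞}
    (hW : AEMeasurable W μ) (h0 : ∀ᵐ x ∂μ, W x ≠ 0) (ht : ∀ᵐ x ∂μ, W x ≠ ⊤) (a b : ℝ) {t : ℝ}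
    (ht0 : 0 ≤ t) (ht1 : t ≤ 1) :
    ∫⁻ x, W x ^ (t * a + (1 - t) * b) ∂μ ≤
      (∫⁻ x, W x ^ a ∂μ) ^ t * (∫⁻ x, W x ^ b ∂μ) ^ (1 - t) := by
  refine le_trans (le_of_eq ?_) (ENNReal.lintegral_mul_norm_pow_le (hW.pow_const a)
    (hW.pow_const b) ht0 (sub_nonneg.2 ht1) (by ring))
  refine lintegral_congr_ae ?_
  filter_upwards [h0, ht] with x hx hx'
  rw [← ENNReal.rpow_mul, ← ENNReal.rpow_mul, ← ENNReal.rpow_add _ _ hx hx', mul_comm a,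
    mul_comm b]
theorem le_pow_mul_of_le_mul_succ {V : ℤ → ℝ} {θ : ℝ} (hθ : 0 ≤ θ) (h : ∀ k, V k ≤ θ * V (k + 1))
    (k : ℤ) (n : ℕ) : V k ≤ θ ^ n * V (k + n) := by
  induction n with
  | zero => simp
  | succ n ih =>
    calc V k ≤ θ ^ n * V (k + n) := ih
      _ ≤ θ ^ n * (θ * V (k + n + 1)) := by gcongr; exact h _
      _ = _ := by rw [pow_succ, mul_assoc]; push_cast; rw [add_assoc]

theorem geometric_of_succ {N : ℤ → ℝ} {g : ℝ} (h : ∀ k, N (k + 1) = g * N k) (k : ℤ) (n : ℕ) :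
    N (k + n) = g ^ n * N k := by
  induction n with
  | zero => simp
  | succ n ih =>
    push_cast
    rw [← add_assoc, h, ih, pow_succ]; ring

theorem growth_le_of_muckenhoupt {N W V : ℤ → ℝ} {q g θ C : ℝ} (hq : 1 < q) (hg : 0 < g)
    (hθ : 0 < θ) (hC : 0 < C) (hN : ∀ k, 0 < N k) (hW : ∀ k, 0 < W k) (hV : ∀ k, 0 < V k)
    (hNg : ∀ k, N (k + 1) = g * N k) (hVθ : ∀ k, V k ≤ θ * V (k + 1))
    (hup : ∀ k, W k * V k ^ (q - 1) ≤ C * N k ^ q)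
    (hlow : ∀ k, N k ^ q ≤ W k * V k ^ (q - 1)) (k : ℤ) (n : ℕ) :
    W (k + n) ≤ C * (g ^ q * θ ^ (q - 1)) ^ n * W k := by
  have hVp : 0 < V (k + n) ^ (q - 1) := rpow_pos_of_pos (hV _) _
  refine le_of_mul_le_mul_right ?_ hVp
  calc W (k + n) * V (k + n) ^ (q - 1) ≤ C * N (k + n) ^ q := hup _
    _ = C * (g ^ q) ^ n * N k ^ q := by
      rw [geometric_of_succ hNg, mul_rpow (by positivity) (hN k).le, ← rpow_natCast,
        ← rpow_natCast, ← rpow_mul hg.le, ← rpow_mul hg.le, mul_comm q]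
      ring
    _ ≤ C * (g ^ q) ^ n * (W k * V k ^ (q - 1)) := by gcongr; exact hlow k
    _ ≤ C * (g ^ q) ^ n * (W k * (θ ^ n * V (k + n)) ^ (q - 1)) := by
      have := hW k
      have := hV k
      have := sub_pos.2 hq
      gcongr
      exact le_pow_mul_of_le_mul_succ hθ.le hVθ k n
    _ = _ := by
      rw [mul_rpow (by positivity) (hV _).le, mul_pow, ← rpow_natCast θ,
        ← rpow_natCast (θ ^ (q - 1)), ← rpow_mul hθ.le, ← rpow_mul hθ.le, mul_comm (q - 1)]
      ring

theorem decay_le_of_reverseHolder {N W R : ℤ → ℝ} {e g θ C : ℝ} (he : 0 < e) (hg : 0 < g)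
    (hθ : 0 < θ) (hN : ∀ k, 0 < N k) (hR : ∀ k, 0 < R k)
    (hNg : ∀ k, N (k + 1) = g * N k) (hRθ : ∀ k, R k ≤ θ * R (k + 1))
    (hup : ∀ k, R k ^ e * N k ^ (1 - e) ≤ C * W k)
    (hlow : ∀ k, W k ≤ R k ^ e * N k ^ (1 - e)) (k : ℤ) (n : ℕ) :
    W k ≤ C * (g ^ (e - 1) * θ ^ e) ^ n * W (k + n) := by
  have h1 : N k ^ (1 - e) = (g ^ (e - 1)) ^ n * N (k + n) ^ (1 - e) := by
    rw [geometric_of_succ hNg, mul_rpow (by positivity) (hN k).le, ← rpow_natCast,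
      ← rpow_natCast, ← rpow_mul hg.le, ← rpow_mul hg.le, ← mul_assoc, ← rpow_add hg]
    ring_nf
    simp
  calc W k ≤ R k ^ e * N k ^ (1 - e) := hlow k
    _ ≤ (θ ^ n * R (k + n)) ^ e * N k ^ (1 - e) := by
      have := hN k
      have := hR k
      gcongr
      exact le_pow_mul_of_le_mul_succ hθ.le hRθ k n
    _ = (g ^ (e - 1) * θ ^ e) ^ n * (R (k + n) ^ e * N (k + n) ^ (1 - e)) := by
      rw [mul_rpow (by positivity) (hR _).le, h1, mul_pow, ← rpow_natCast θ,
        ← rpow_natCast (θ ^ e), ← rpow_mul hθ.le, ← rpow_mul hθ.le, mul_comm e]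
      ring
    _ ≤ (g ^ (e - 1) * θ ^ e) ^ n * (C * W (k + n)) :=
      mul_le_mul_of_nonneg_left (hup _) (by positivity)
    _ = _ := by ring

/-- A power-weight kernel times volume-normalized sequences with controlled growth has entries that
decay geometrically away from the diagonal. -/
theorem matrix_entry_le {W U N : ℤ → ℝ} {D s σ p C ω α β η : ℝ} (hp : 1 < p) (hC : 0 < C)
    (hω : 0 < ω) (hα : 0 < α) (hβ : 0 < β)
    (hW : ∀ k, 0 < W k) (hU : ∀ k, 0 < U k) (hN : ∀ k : ℤ, N k = ω * (2 : ℝ) ^ (k * D))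
    (hAp : ∀ k, U k ^ (1 - 1 / p) * W k ^ (1 / p) ≤ C * N k)
    (hgrow : ∀ (k : ℤ) (n : ℕ), W (k + n) ≤ C * α ^ n * W k)
    (hdec : ∀ (k : ℤ) (n : ℕ), W k ≤ C * β ^ n * W (k + n))
    (hαη : (2 : ℝ) ^ (-(D + s - σ)) * α ^ (1 / p) ≤ η)
    (hβη : (2 : ℝ) ^ σ * β ^ (1 / p) ≤ η) (j k : ℤ) :
    (2 : ℝ) ^ (k * s - max j k * (D + s - 2 * σ) - j * σ - k * σ) *
      U k ^ (1 - 1 / p) * W j ^ (1 / p) ≤ (C * C ^ (1 / p) * ω) * η ^ (j - k).natAbs := by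
  have hp0 : 0 < p := by linarith
  have main : ∀ (γ x y : ℝ) (n : ℕ), 0 < γ → W j ≤ C * γ ^ n * W k → x + k * D = n * y →
      (2 : ℝ) ^ y * γ ^ (1 / p) ≤ η →
      (2 : ℝ) ^ x * U k ^ (1 - 1 / p) * W j ^ (1 / p) ≤ (C * C ^ (1 / p) * ω) * η ^ n := by
    intro γ x y n hγ hWj hx hη
    have hUp : 0 < U k ^ (1 - 1 / p) := rpow_pos_of_pos (hU k) _
    have := hW j
    have := hW k
    calc (2 : ℝ) ^ x * U k ^ (1 - 1 / p) * W j ^ (1 / p)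
        ≤ (2 : ℝ) ^ x * U k ^ (1 - 1 / p) * (C * γ ^ n * W k) ^ (1 / p) := by gcongr
      _ = (2 : ℝ) ^ x * C ^ (1 / p) * (γ ^ (1 / p)) ^ n *
          (U k ^ (1 - 1 / p) * W k ^ (1 / p)) := by
        rw [mul_rpow (by positivity) (by positivity), mul_rpow (by positivity) (by positivity),
          ← rpow_natCast γ, ← rpow_natCast (γ ^ (1 / p)), ← rpow_mul hγ.le, ← rpow_mul hγ.le,
          mul_comm (1 / p)]
        ring
      _ ≤ (2 : ℝ) ^ x * C ^ (1 / p) * (γ ^ (1 / p)) ^ n * (C * N k) :=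
        mul_le_mul_of_nonneg_left (hAp k) (by positivity)
      _ = (C * C ^ (1 / p) * ω) * ((2 : ℝ) ^ (x + k * D) * (γ ^ (1 / p)) ^ n) := by
        rw [hN, rpow_add two_pos]; ring
      _ = (C * C ^ (1 / p) * ω) * ((2 : ℝ) ^ y * γ ^ (1 / p)) ^ n := by
        rw [hx, mul_comm (n : ℝ), rpow_mul two_pos.le, rpow_natCast, mul_pow]
      _ ≤ _ := by gcongr
  rcases le_total k j with h | h
  · obtain ⟨n, rfl⟩ := Int.le.dest h
    have hn : (k + n - k : ℤ).natAbs = n := by simp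
    rw [hn]
    refine main α _ _ n hα (hgrow k n) ?_ hαη
    have : max ((k + n : ℤ) : ℝ) k = k + n := by simp
    push_cast at this ⊢; rw [this]; ring
  · obtain ⟨n, rfl⟩ := Int.le.dest h
    have hn : (j - (j + n) : ℤ).natAbs = n := by simp
    rw [hn]
    refine main β _ _ n hβ (hdec j n) ?_ hβη
    have : max (j : ℝ) ((j + n : ℤ) : ℝ) = j + n := by simp
    push_cast at this ⊢; rw [this]; ring

theorem exists_tsum_pow_natAbs_le {η : ℝ} (h0 : 0 ≤ η) (h1 : η < 1) :
    ∃ M : ℝ, 0 < M ∧ ∑' k : ℤ, ENNReal.ofReal (η ^ k.natAbs) ≤ ENNReal.ofReal M := by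
  have hs : Summable fun k : ℤ => η ^ k.natAbs := by
    refine Summable.of_nat_of_neg ?_ ?_ <;> simpa using summable_geometric_of_lt_one h0 h1
  refine ⟨∑' k : ℤ, η ^ k.natAbs, hs.tsum_pos (fun _ => by positivity) 0 (by simp), ?_⟩
  rw [ENNReal.ofReal_tsum_of_nonneg (fun _ => by positivity) hs]

/-- The real number `∫_S w^a`. -/
noncomputable def powInt {d : ℕ} (w : EuclideanSpace ℝ (Fin d) → ℝ) (a : ℝ)
    (S : Set (EuclideanSpace ℝ (Fin d))) : ℝ := (∫⁻ x in S, ENNReal.ofReal (w x) ^ a).toReal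

theorem powInt_nonneg {d : ℕ} (w : EuclideanSpace ℝ (Fin d) → ℝ) (a : ℝ)
    (S : Set (EuclideanSpace ℝ (Fin d))) : 0 ≤ powInt w a S := ENNReal.toReal_nonneg

theorem powInt_zero {d : ℕ} (w : EuclideanSpace ℝ (Fin d) → ℝ)
    (S : Set (EuclideanSpace ℝ (Fin d))) : powInt w 0 S = volume.real S := by
  simp [powInt, Measure.real]

theorem powInt_mono {d : ℕ} {w : EuclideanSpace ℝ (Fin d) → ℝ} {a : ℝ}
    {S T : Set (EuclideanSpace ℝ (Fin d))} (h : S ⊆ T)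
    (hT : ∫⁻ x in T, ENNReal.ofReal (w x) ^ a ≠ ⊤) : powInt w a S ≤ powInt w a T :=
  ENNReal.toReal_mono hT (lintegral_mono_set h)

theorem powInt_le_log_convex {d : ℕ} {w : EuclideanSpace ℝ (Fin d) → ℝ}
    (hw : AEMeasurable w volume) {S : Set (EuclideanSpace ℝ (Fin d))}
    (hpos : ∀ᵐ x ∂volume.restrict S, 0 < w x) {a b t : ℝ} (ht0 : 0 ≤ t) (ht1 : t ≤ 1)
    (ha : ∫⁻ x in S, ENNReal.ofReal (w x) ^ a ≠ ⊤)
    (hb : ∫⁻ x in S, ENNReal.ofReal (w x) ^ b ≠ ⊤) :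
    powInt w (t * a + (1 - t) * b) S ≤ powInt w a S ^ t * powInt w b S ^ (1 - t) := by
  rw [powInt, powInt, powInt, ENNReal.toReal_rpow, ENNReal.toReal_rpow, ← ENNReal.toReal_mul]
  refine ENNReal.toReal_mono (ENNReal.mul_ne_top (ENNReal.rpow_ne_top_of_nonneg ht0 ha)
    (ENNReal.rpow_ne_top_of_nonneg (sub_nonneg.2 ht1) hb)) ?_
  refine lintegral_rpow_le_log_convex hw.restrict.ennreal_ofReal ?_ (by simp) a b ht0 ht1
  filter_upwards [hpos] with x hx
  simpa using hx

theorem lintegral_ball_ne_top {d : ℕ} {w : EuclideanSpace ℝ (Fin d) → ℝ}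
    (hw : LocallyIntegrable w) (c : EuclideanSpace ℝ (Fin d)) (ρ : ℝ) :
    ∫⁻ x in ball c ρ, ENNReal.ofReal (w x) ^ (1 : ℝ) ≠ ⊤ := by
  simp only [ENNReal.rpow_one]
  have h := (hw.integrableOn_isCompact (isCompact_closedBall c ρ)).mono_set ball_subset_closedBall
  exact h.lintegral_lt_top.ne

theorem reverseHolder_powInt {d : ℕ} {r : ℝ} (hr : 1 < r)
    {w : EuclideanSpace ℝ (Fin d) → ℝ} (h : IsReverseHolder d r w) :
    ∃ C : ℝ, 0 < C ∧ ∀ (c : EuclideanSpace ℝ (Fin d)) (ρ : ℝ), 0 < ρ →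
      ∫⁻ x in ball c ρ, ENNReal.ofReal (w x) ^ r ≠ ⊤ ∧
      powInt w r (ball c ρ) ^ (1 / r) * volume.real (ball c ρ) ^ (1 - 1 / r) ≤
        C * powInt w 1 (ball c ρ) := by
  obtain ⟨hw0, hwl, C, hC, H⟩ := h
  have hr0 : 0 < r := by linarith
  refine ⟨C, hC, fun c ρ hρ => ?_⟩
  have H := H c ρ hρ
  have hN0 : volume (ball c ρ) ≠ 0 := (measure_ball_pos _ _ hρ).ne'
  have hNt : volume (ball c ρ) ≠ ⊤ := measure_ball_lt_top.ne
  have hI := lintegral_ball_ne_top hwl c ρ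
  have e1 : ∫⁻ x in ball c ρ, ENNReal.ofReal (w x ^ r)
      = ∫⁻ x in ball c ρ, ENNReal.ofReal (w x) ^ r :=
    lintegral_congr fun x => (ENNReal.ofReal_rpow_of_nonneg (hw0 x) hr0.le).symm
  have e2 : ∫⁻ x in ball c ρ, ENNReal.ofReal (w x)
      = ∫⁻ x in ball c ρ, ENNReal.ofReal (w x) ^ (1 : ℝ) := by simp
  rw [ballAvg, ballAvg, e1, e2] at H
  have hrt : ENNReal.ofReal C * ((∫⁻ x in ball c ρ, ENNReal.ofReal (w x) ^ (1 : ℝ))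
      / volume (ball c ρ)) ≠ ⊤ :=
    ENNReal.mul_ne_top ENNReal.ofReal_ne_top (ENNReal.div_ne_top hI hN0)
  constructor
  · intro htop
    rw [htop, ENNReal.top_div_of_ne_top hNt, ENNReal.top_rpow_of_pos (by positivity)] at H
    exact hrt (top_le_iff.1 H)
  · have H' := ENNReal.toReal_mono hrt H
    rw [← ENNReal.toReal_rpow, ENNReal.toReal_mul, ENNReal.toReal_div, ENNReal.toReal_div,
      ENNReal.toReal_ofReal hC.le] at H'
    change (powInt w r (ball c ρ) / volume.real (ball c ρ)) ^ (1 / r) ≤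
      C * (powInt w 1 (ball c ρ) / volume.real (ball c ρ)) at H'
    have hN : 0 < volume.real (ball c ρ) := ENNReal.toReal_pos hN0 hNt
    rw [div_rpow (powInt_nonneg _ _ _) hN.le, ← mul_div_assoc, div_le_div_iff₀
      (by positivity) hN] at H'
    rw [rpow_sub hN, rpow_one, ← mul_div_assoc, div_le_iff₀ (by positivity)]
    exact H'

theorem lintegral_ball_ne_zero {d : ℕ} {w : EuclideanSpace ℝ (Fin d) → ℝ}
    (hw : AEMeasurable w volume) (hpos : ∀ᵐ x, 0 < w x) (a : ℝ)
    {S : Set (EuclideanSpace ℝ (Fin d))} (hS : volume S ≠ 0) :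
    ∫⁻ x in S, ENNReal.ofReal (w x) ^ a ≠ 0 := by
  intro h
  rw [lintegral_eq_zero_iff' (hw.restrict.ennreal_ofReal.pow_const a)] at h
  have : ∀ᵐ x ∂volume.restrict S, False := by
    filter_upwards [h, ae_restrict_of_ae hpos] with x hx hx'
    rw [Pi.zero_apply, ENNReal.ofReal_rpow_of_pos hx', ENNReal.ofReal_eq_zero] at hx
    exact absurd hx (not_le.2 (rpow_pos_of_pos hx' _))
  rw [Filter.eventually_false_iff_eq_bot, ae_eq_bot, Measure.restrict_eq_zero] at this
  exact hS this

theorem muckenhoupt_powInt {d : ℕ} {q : ℝ} (hq : 1 < q)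
    {w : EuclideanSpace ℝ (Fin d) → ℝ} (h : IsMuckenhoupt d q w) (hpos : ∀ᵐ x, 0 < w x) :
    ∃ C : ℝ, 0 < C ∧ ∀ (c : EuclideanSpace ℝ (Fin d)) (ρ : ℝ), 0 < ρ →
      ∫⁻ x in ball c ρ, ENNReal.ofReal (w x) ^ (-1 / (q - 1)) ≠ ⊤ ∧
      powInt w 1 (ball c ρ) * powInt w (-1 / (q - 1)) (ball c ρ) ^ (q - 1) ≤
        C * volume.real (ball c ρ) ^ q := by
  obtain ⟨hw0, hwl, C, hC, H⟩ := h
  have hq0 : 0 < q - 1 := by linarith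
  refine ⟨C, hC, fun c ρ hρ => ?_⟩
  have H := H c ρ hρ
  have hN0 : volume (ball c ρ) ≠ 0 := (measure_ball_pos _ _ hρ).ne'
  have hNt : volume (ball c ρ) ≠ ⊤ := measure_ball_lt_top.ne
  have hI0 := lintegral_ball_ne_zero hwl.aestronglyMeasurable.aemeasurable hpos 1 hN0
  have e1 : ∫⁻ x in ball c ρ, ENNReal.ofReal (w x ^ (-1 / (q - 1)))
      = ∫⁻ x in ball c ρ, ENNReal.ofReal (w x) ^ (-1 / (q - 1)) := by
    refine lintegral_congr_ae ?_
    filter_upwards [ae_restrict_of_ae hpos] with x hx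
    exact (ENNReal.ofReal_rpow_of_pos hx).symm
  have e2 : ∫⁻ x in ball c ρ, ENNReal.ofReal (w x)
      = ∫⁻ x in ball c ρ, ENNReal.ofReal (w x) ^ (1 : ℝ) := by simp
  rw [ballAvg, ballAvg, e1, e2] at H
  constructor
  · intro htop
    rw [htop, ENNReal.top_div_of_ne_top hNt, ENNReal.top_rpow_of_pos hq0,
      ENNReal.mul_top (ENNReal.div_ne_zero.2 ⟨hI0, hNt⟩)] at H
    exact ENNReal.ofReal_ne_top (top_le_iff.1 H)
  · have H' := ENNReal.toReal_mono ENNReal.ofReal_ne_top H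
    rw [ENNReal.toReal_mul, ← ENNReal.toReal_rpow, ENNReal.toReal_div, ENNReal.toReal_div,
      ENNReal.toReal_ofReal hC.le] at H'
    change powInt w 1 (ball c ρ) / volume.real (ball c ρ) *
      (powInt w (-1 / (q - 1)) (ball c ρ) / volume.real (ball c ρ)) ^ (q - 1) ≤ C at H'
    have hN : 0 < volume.real (ball c ρ) := ENNReal.toReal_pos hN0 hNt
    rw [div_rpow (powInt_nonneg _ _ _) hN.le, div_mul_div_comm, div_le_iff₀ (by positivity)] at H'
    refine H'.trans (le_of_eq ?_)
    congr 1
    nth_rw 1 [← rpow_one (volume.real (ball c ρ))]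
    rw [← rpow_add hN]
    ring_nf

theorem support_density_of_reverseHolder {d : ℕ} {r : ℝ} (hr : 1 < r)
    {w : EuclideanSpace ℝ (Fin d) → ℝ} (h : IsReverseHolder d r w) :
    ∃ κ : ℝ, 0 < κ ∧ ∀ (c : EuclideanSpace ℝ (Fin d)) (ρ : ℝ), 0 < ρ →
      volume (ball c ρ ∩ {x | w x ≠ 0}) ≠ 0 →
      κ * volume.real (ball c ρ) ≤ volume.real (ball c ρ ∩ {x | w x ≠ 0}) := by
  obtain ⟨C, hC, H⟩ := reverseHolder_powInt hr h
  obtain ⟨hw0, hwl, -⟩ := h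
  have hwm := hwl.aestronglyMeasurable.aemeasurable
  have hr0 : 0 < r := by linarith
  have he : 0 < 1 - 1 / r := by
    rw [sub_pos, div_lt_one hr0]; exact hr
  refine ⟨(C ^ (1 / (1 - 1 / r)))⁻¹, by positivity, fun c ρ hρ hne => ?_⟩
  obtain ⟨hRt, H⟩ := H c ρ hρ
  set B := ball c ρ
  set E := {x | w x ≠ 0} with hE
  have hEm : NullMeasurableSet E volume :=
    hwm.nullMeasurable (measurableSet_singleton (0 : ℝ)).compl
  have hBE : NullMeasurableSet (B ∩ E) volume := measurableSet_ball.nullMeasurableSet.inter hEm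
  have hposBE : ∀ᵐ x ∂volume.restrict (B ∩ E), 0 < w x := by
    rw [ae_restrict_iff'₀ hBE]
    exact .of_forall fun x hx => lt_of_le_of_ne (hw0 x) (Ne.symm hx.2)
  have hIt := lintegral_ball_ne_top hwl c ρ
  have hsub : B ∩ E ⊆ B := Set.inter_subset_left
  have h1 := powInt_le_log_convex hwm hposBE (a := r) (b := 0) (t := 1 / r) (by positivity)
    (by linarith) (ne_top_of_le_ne_top hRt (lintegral_mono_set hsub))
    (by simpa using (measure_mono hsub).trans_lt measure_ball_lt_top |>.ne)
  rw [powInt_zero, one_div_mul_cancel hr0.ne', mul_zero, add_zero] at h1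
  have hI : powInt w 1 (B ∩ E) = powInt w 1 B := by
    rw [powInt, powInt]
    congr 1
    simp only [ENNReal.rpow_one]
    have hdiff : ∫⁻ x in B \ E, ENNReal.ofReal (w x) = 0 := by
      refine (lintegral_congr_ae ?_).trans lintegral_zero
      rw [Filter.EventuallyEq, ae_restrict_iff'₀ (measurableSet_ball.nullMeasurableSet.diff hEm)]
      refine .of_forall fun x hx => ?_
      have : w x = 0 := by simpa [hE] using hx.2
      simp [this]
    have hsplit := measure_inter_add_sdiff₀ (μ := volume.withDensity fun x => ENNReal.ofReal (w x))
      B (hEm.mono_ac (withDensity_absolutelyContinuous _ _))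
    rw [withDensity_apply₀ _ hBE, withDensity_apply₀ _
      (measurableSet_ball.nullMeasurableSet.diff hEm), withDensity_apply _ measurableSet_ball,
      hdiff, add_zero] at hsplit
    exact hsplit
  have hIpos : 0 < powInt w 1 B := by
    rw [← hI]
    refine ENNReal.toReal_pos ?_ (ne_top_of_le_ne_top hIt (lintegral_mono_set hsub))
    intro h0
    rw [lintegral_eq_zero_iff' (hwm.restrict.ennreal_ofReal.pow_const 1)] at h0
    have : ∀ᵐ x ∂volume.restrict (B ∩ E), False := by
      filter_upwards [h0, hposBE] with x hx hx'
      simp at hx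
      linarith
    rw [Filter.eventually_false_iff_eq_bot, ae_eq_bot, Measure.restrict_eq_zero] at this
    exact hne this
  have hN : 0 ≤ volume.real B := measureReal_nonneg
  have hm : 0 ≤ volume.real (B ∩ E) := measureReal_nonneg
  have h2 : volume.real B ^ (1 - 1 / r) ≤ C * volume.real (B ∩ E) ^ (1 - 1 / r) := by
    refine le_of_mul_le_mul_left ?_ hIpos
    calc powInt w 1 B * volume.real B ^ (1 - 1 / r)
        ≤ (powInt w r (B ∩ E) ^ (1 / r) * volume.real (B ∩ E) ^ (1 - 1 / r)) *
          volume.real B ^ (1 - 1 / r) := by rw [← hI]; gcongr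
      _ ≤ (powInt w r B ^ (1 / r) * volume.real (B ∩ E) ^ (1 - 1 / r)) *
          volume.real B ^ (1 - 1 / r) := by
        have := powInt_mono hsub hRt
        have := powInt_nonneg w r (B ∩ E)
        gcongr
      _ = (powInt w r B ^ (1 / r) * volume.real B ^ (1 - 1 / r)) *
          volume.real (B ∩ E) ^ (1 - 1 / r) := by ring
      _ ≤ (C * powInt w 1 B) * volume.real (B ∩ E) ^ (1 - 1 / r) := by gcongr
      _ = _ := by ring
  rw [inv_mul_le_iff₀ (by positivity)]
  have h3 := rpow_le_rpow (by positivity) h2 (z := 1 / (1 - 1 / r)) (by positivity)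
  rwa [mul_rpow hC.le (by positivity), ← rpow_mul hN, ← rpow_mul hm, mul_one_div_cancel he.ne',
    rpow_one, rpow_one] at h3

theorem volume_real_ball_eq {d : ℕ} (hd : 0 < d) (c : EuclideanSpace ℝ (Fin d)) {ρ : ℝ}
    (hρ : 0 ≤ ρ) : volume.real (ball c ρ) =
      ρ ^ d * volume.real (ball (0 : EuclideanSpace ℝ (Fin d)) 1) := by
  have : Nonempty (Fin d) := ⟨⟨0, hd⟩⟩
  rw [Measure.real, Measure.addHaar_ball volume c hρ, ENNReal.toReal_mul,
    ENNReal.toReal_ofReal (by positivity), finrank_euclideanSpace_fin, Measure.real]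

/-- A reverse Hölder weight either vanishes almost everywhere or is positive almost everywhere. -/
theorem ae_eq_zero_or_ae_pos_of_reverseHolder {d : ℕ} (hd : 0 < d) {r : ℝ} (hr : 1 < r)
    {w : EuclideanSpace ℝ (Fin d) → ℝ} (h : IsReverseHolder d r w) :
    (∀ᵐ x, w x = 0) ∨ ∀ᵐ x, 0 < w x := by
  obtain ⟨κ, hκ, H⟩ := support_density_of_reverseHolder hr h
  have : Nonempty (Fin d) := ⟨⟨0, hd⟩⟩
  obtain ⟨hw0, hwl, -⟩ := h
  set E := {x | w x ≠ 0} with hE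
  have hEm : NullMeasurableSet E volume :=
    hwl.aestronglyMeasurable.aemeasurable.nullMeasurable
      (measurableSet_singleton (0 : ℝ)).compl
  by_cases hE0 : volume E = 0
  · exact Or.inl (by rwa [ae_iff])
  right
  obtain ⟨l, hl1, hl⟩ : ∃ l : ℝ, 1 < l ∧ l ^ d * (1 - κ) < 1 := by
    have hcont : Filter.Tendsto (fun l : ℝ => l ^ d * (1 - κ)) (nhdsWithin 1 (Set.Ioi 1))
        (nhds (1 ^ d * (1 - κ))) :=
      (Continuous.tendsto (by fun_prop) 1).mono_left nhdsWithin_le_nhds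
    have hlt : (1 : ℝ) ^ d * (1 - κ) < 1 := by simp [hκ]
    obtain ⟨l, h1, h2⟩ := ((hcont.eventually_lt_const hlt).and self_mem_nhdsWithin).exists
    exact ⟨l, h2, h1⟩
  set ω := volume.real (ball (0 : EuclideanSpace ℝ (Fin d)) 1) with hω
  have hωpos : 0 < ω :=
    ENNReal.toReal_pos (measure_ball_pos _ _ one_pos).ne' measure_ball_lt_top.ne
  have null_ball_extend : ∀ (z : EuclideanSpace ℝ (Fin d)) (ρ : ℝ), 0 < ρ →
      volume (ball z ρ ∩ E) = 0 →
      volume (ball z (l * ρ) ∩ E) = 0 := by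
    intro z ρ hρ hz
    by_contra hne
    have hlρ : 0 < l * ρ := by positivity
    have h1 := H z (l * ρ) hlρ hne
    have hsub : ball z ρ ⊆ ball z (l * ρ) := ball_subset_ball (by nlinarith)
    have h2 : volume.real (ball z (l * ρ) ∩ E) ≤
        volume.real (ball z (l * ρ)) - volume.real (ball z ρ) := by
      rw [← measureReal_sdiff hsub measurableSet_ball measure_ball_lt_top.ne]
      have hle : volume (ball z (l * ρ) ∩ E) ≤ volume (ball z (l * ρ) \ ball z ρ) := by
        calc volume (ball z (l * ρ) ∩ E)
            ≤ volume ((ball z (l * ρ) \ ball z ρ) ∪ (ball z ρ ∩ E)) := by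
              refine measure_mono fun x hx => ?_
              by_cases hx' : x ∈ ball z ρ
              · exact Or.inr ⟨hx', hx.2⟩
              · exact Or.inl ⟨hx.1, hx'⟩
          _ ≤ _ := (measure_union_le _ _).trans (by rw [hz, add_zero])
      exact ENNReal.toReal_mono
        (measure_ne_top_of_subset Set.sdiff_subset measure_ball_lt_top.ne) hle
    have h3 := h1.trans h2
    rw [volume_real_ball_eq hd z hlρ.le, volume_real_ball_eq hd z hρ.le, mul_pow] at h3
    have hρd : 0 < ρ ^ d * ω := by positivity
    nlinarith
  have hpos : ∀ (z : EuclideanSpace ℝ (Fin d)) (ρ : ℝ), 0 < ρ → volume (ball z ρ ∩ E) ≠ 0 := by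
    intro z ρ hρ hz
    refine hE0 ?_
    have hn : ∀ n : ℕ, volume (ball z (l ^ n * ρ) ∩ E) = 0 := by
      intro n
      induction n with
      | zero => simpa using hz
      | succ n ih =>
        rw [pow_succ', mul_assoc]
        exact null_ball_extend z _ (by positivity) ih
    refine measure_mono_null (fun x hx => ?_) (measure_iUnion_null hn)
    obtain ⟨n, hn⟩ := pow_unbounded_of_one_lt (dist x z / ρ) hl1
    exact Set.mem_iUnion.2 ⟨n, mem_ball.2 ((div_lt_iff₀ hρ).1 hn), hx⟩
  have hZ : volume Eᶜ = 0 := by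
    have hd1 := Besicovitch.ae_tendsto_measure_inter_div volume Eᶜ
    have hfalse : ∀ᵐ x ∂volume.restrict Eᶜ, False := by
      filter_upwards [hd1] with x hx
      have hx' := (ENNReal.tendsto_toReal ENNReal.one_ne_top).comp hx
      refine absurd (le_of_tendsto hx' (b := 1 - κ) ?_) (by simp [hκ])
      filter_upwards [self_mem_nhdsWithin] with ρ hρ
      have hρ : 0 < ρ := hρ
      simp only [Function.comp, ENNReal.toReal_div]
      have hb : volume (closedBall x ρ) = volume (ball x ρ) :=
        Measure.addHaar_closedBall_eq_addHaar_ball volume x ρ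
      have hbpos : 0 < (volume (ball x ρ)).toReal :=
        ENNReal.toReal_pos (measure_ball_pos _ _ hρ).ne' measure_ball_lt_top.ne
      rw [hb, div_le_iff₀ hbpos]
      have h1 := H x ρ hρ (hpos x ρ hρ)
      have h2 : volume.real (ball x ρ ∩ E) ≤ volume.real (closedBall x ρ ∩ E) :=
        measureReal_mono (Set.inter_subset_inter_left _ ball_subset_closedBall)
          (measure_ne_top_of_subset Set.inter_subset_left measure_closedBall_lt_top.ne)
      have h3 := measureReal_inter_add_sdiff₀ (μ := volume) (s := closedBall x ρ) hEm
        measure_closedBall_lt_top.ne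
      have h4 : volume.real (closedBall x ρ) = volume.real (ball x ρ) := by
        rw [Measure.real, hb, Measure.real]
      rw [Set.inter_comm]
      change volume.real (closedBall x ρ ∩ Eᶜ) ≤ (1 - κ) * volume.real (ball x ρ)
      rw [← Set.sdiff_eq]
      linarith
    rwa [Filter.eventually_false_iff_eq_bot, ae_eq_bot, Measure.restrict_eq_zero] at hfalse
  have : ∀ᵐ x, w x ≠ 0 := by rw [ae_iff]; exact hZ
  filter_upwards [this] with x hx
  exact lt_of_le_of_ne (hw0 x) hx.symm

theorem volume_rpow_le_mul_powInt {d : ℕ} {q : ℝ} (hq : 1 < q)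
    {w : EuclideanSpace ℝ (Fin d) → ℝ} (hw : AEMeasurable w volume) (hpos : ∀ᵐ x, 0 < w x)
    {S : Set (EuclideanSpace ℝ (Fin d))}
    (h1 : ∫⁻ x in S, ENNReal.ofReal (w x) ^ (1 : ℝ) ≠ ⊤)
    (h2 : ∫⁻ x in S, ENNReal.ofReal (w x) ^ (-1 / (q - 1)) ≠ ⊤) :
    volume.real S ^ q ≤ powInt w 1 S * powInt w (-1 / (q - 1)) S ^ (q - 1) := by
  have hq0 : 0 < q := by linarith
  have hq1 : q - 1 ≠ 0 := by linarith
  have h := powInt_le_log_convex hw (ae_restrict_of_ae hpos) (t := 1 / q) (by positivity)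
    (by rw [div_le_one hq0]; exact hq.le) h1 h2
  have e : 1 / q * 1 + (1 - 1 / q) * (-1 / (q - 1)) = 0 := by field_simp; ring
  rw [e, powInt_zero] at h
  have h' := rpow_le_rpow measureReal_nonneg h hq0.le
  have n1 := powInt_nonneg w 1 S
  have n2 := powInt_nonneg w (-1 / (q - 1)) S
  rw [mul_rpow (by positivity) (by positivity), ← rpow_mul n1, ← rpow_mul n2,
    one_div_mul_cancel hq0.ne', rpow_one] at h'
  have e' : (1 - 1 / q) * q = q - 1 := by field_simp
  rwa [e'] at h'

theorem powInt_le_mul_powInt_annulus {d : ℕ} (hd : 0 < d) {q r : ℝ} (hq : 1 < q) (hr : 1 < r)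
    {w : EuclideanSpace ℝ (Fin d) → ℝ} (hA : IsMuckenhoupt d q w) (hR : IsReverseHolder d r w)
    (hpos : ∀ᵐ x, 0 < w x) :
    ∃ K : ℝ, 0 < K ∧ ∀ ρ : ℝ, 0 < ρ →
      powInt w (-1 / (q - 1)) (ball 0 (2 * ρ)) ≤
        K * powInt w (-1 / (q - 1)) (ball 0 (2 * ρ) \ ball 0 ρ) ∧
      powInt w r (ball 0 (2 * ρ)) ≤ K * powInt w r (ball 0 (2 * ρ) \ ball 0 ρ) := by
  obtain ⟨C, hC, HA⟩ := muckenhoupt_powInt hq hA hpos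
  obtain ⟨C', hC', HR⟩ := reverseHolder_powInt hr hR
  have hwm := hA.2.1.aestronglyMeasurable.aemeasurable
  have hq0 : 0 < q - 1 := by linarith
  have hr0 : 0 < r := by linarith
  set K₁ := (C * 2 ^ q) ^ (1 / (q - 1)) with hK₁
  set K₂ := (C' * (C * 2 ^ q)) ^ r with hK₂
  have hK₁p : 0 < K₁ := by positivity
  have hK₂p : 0 < K₂ := by positivity
  refine ⟨K₁ + K₂, by positivity, fun ρ hρ => ?_⟩
  obtain ⟨hVt, HA⟩ := HA 0 (2 * ρ) (by positivity)
  obtain ⟨hRt, HR⟩ := HR 0 (2 * ρ) (by positivity)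
  have hWt := lintegral_ball_ne_top hA.2.1 0 (2 * ρ)
  set B := ball (0 : EuclideanSpace ℝ (Fin d)) (2 * ρ) with hB
  set E := B \ ball 0 ρ with hE
  have hBE : E ⊆ B := Set.sdiff_subset
  have hB0 : volume B ≠ 0 := (measure_ball_pos _ _ (by positivity)).ne'
  have hBt : volume B ≠ ⊤ := measure_ball_lt_top.ne
  have hN : 0 < volume.real B := ENNReal.toReal_pos hB0 hBt
  have hEN : volume.real E ≤ volume.real B := measureReal_mono hBE hBt
  have hNE : volume.real B ≤ 2 * volume.real E := by
    have hsub : ball (0 : EuclideanSpace ℝ (Fin d)) ρ ⊆ B := ball_subset_ball (by linarith)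
    rw [hE, measureReal_sdiff hsub measurableSet_ball measure_ball_lt_top.ne, hB,
      volume_real_ball_eq hd 0 (by positivity), volume_real_ball_eq hd 0 hρ.le, mul_pow]
    have h2 : (2 : ℝ) ≤ 2 ^ d := by
      calc (2 : ℝ) = 2 ^ 1 := by norm_num
        _ ≤ 2 ^ d := pow_le_pow_right₀ (by norm_num) hd
    have : 0 ≤ ρ ^ d * volume.real (ball (0 : EuclideanSpace ℝ (Fin d)) 1) := by positivity
    nlinarith
  have hWE := ne_top_of_le_ne_top hWt (lintegral_mono_set hBE)
  have hVE := ne_top_of_le_ne_top hVt (lintegral_mono_set hBE)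
  have hRE := ne_top_of_le_ne_top hRt (lintegral_mono_set hBE)
  have hW : 0 < powInt w 1 B := ENNReal.toReal_pos (lintegral_ball_ne_zero hwm hpos _ hB0) hWt
  have hV : 0 < powInt w (-1 / (q - 1)) B :=
    ENNReal.toReal_pos (lintegral_ball_ne_zero hwm hpos _ hB0) hVt
  have hWm : powInt w 1 E ≤ powInt w 1 B := powInt_mono hBE hWt
  have hVm : powInt w (-1 / (q - 1)) E ≤ powInt w (-1 / (q - 1)) B := powInt_mono hBE hVt
  have nW := powInt_nonneg w 1 E
  have nV := powInt_nonneg w (-1 / (q - 1)) E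
  have nR := powInt_nonneg w r E
  have nR' := powInt_nonneg w r B
  have hH := volume_rpow_le_mul_powInt hq hwm hpos hWE hVE
  have key : powInt w 1 B * powInt w (-1 / (q - 1)) B ^ (q - 1) ≤
      C * 2 ^ q * (powInt w 1 E * powInt w (-1 / (q - 1)) E ^ (q - 1)) := by
    calc _ ≤ C * volume.real B ^ q := HA
      _ ≤ C * (2 * volume.real E) ^ q := by gcongr
      _ = C * 2 ^ q * volume.real E ^ q := by
        rw [mul_rpow two_pos.le measureReal_nonneg]; ring
      _ ≤ _ := by gcongr
  constructor
  · have h1 : powInt w (-1 / (q - 1)) B ^ (q - 1) ≤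
        C * 2 ^ q * powInt w (-1 / (q - 1)) E ^ (q - 1) := by
      refine le_of_mul_le_mul_left (key.trans ?_) hW
      rw [mul_left_comm (powInt w 1 B)]
      gcongr
    have h2 := rpow_le_rpow (by positivity) h1 (z := 1 / (q - 1)) (by positivity)
    rw [mul_rpow (by positivity) (by positivity), ← rpow_mul hV.le, ← rpow_mul nV,
      mul_one_div_cancel hq0.ne', rpow_one, rpow_one] at h2
    exact h2.trans (by gcongr; linarith)
  · have h1 : powInt w 1 B ≤ C * 2 ^ q * powInt w 1 E := by
      have hVp : 0 < powInt w (-1 / (q - 1)) B ^ (q - 1) := by positivity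
      refine le_of_mul_le_mul_right (key.trans ?_) hVp
      rw [← mul_assoc]
      gcongr
    have h2 := powInt_le_log_convex hwm (ae_restrict_of_ae (s := E) hpos) (a := r) (b := 0)
      (t := 1 / r) (by positivity) (by rw [div_le_one hr0]; exact hr.le) hRE
      (by simpa using measure_ne_top_of_subset hBE hBt)
    rw [powInt_zero, one_div_mul_cancel hr0.ne', mul_zero, add_zero] at h2
    have he : 0 ≤ 1 - 1 / r := by rw [sub_nonneg, div_le_one hr0]; exact hr.le
    have h3 : powInt w r B ^ (1 / r) ≤ C' * (C * 2 ^ q) * powInt w r E ^ (1 / r) := by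
      have hNp : 0 < volume.real B ^ (1 - 1 / r) := by positivity
      refine le_of_mul_le_mul_right (HR.trans ?_) hNp
      calc C' * powInt w 1 B ≤ C' * (C * 2 ^ q * powInt w 1 E) := by gcongr
        _ ≤ C' * (C * 2 ^ q * (powInt w r E ^ (1 / r) * volume.real E ^ (1 - 1 / r))) := by
          gcongr
        _ ≤ C' * (C * 2 ^ q * (powInt w r E ^ (1 / r) * volume.real B ^ (1 - 1 / r))) := by
          gcongr
        _ = _ := by ring
    have h4 := rpow_le_rpow (by positivity) h3 hr0.le
    rw [mul_rpow (by positivity) (by positivity), ← rpow_mul nR', ← rpow_mul nR,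
      one_div_mul_cancel hr0.ne', rpow_one, rpow_one] at h4
    exact h4.trans (by gcongr; linarith)

theorem exists_reverse_doubling {d : ℕ} {w : EuclideanSpace ℝ (Fin d) → ℝ} {a K : ℝ} (hK : 0 < K)
    (hfin : ∀ ρ : ℝ, 0 < ρ → ∫⁻ x in ball 0 ρ, ENNReal.ofReal (w x) ^ a ≠ ⊤)
    (h : ∀ ρ : ℝ, 0 < ρ → powInt w a (ball 0 (2 * ρ)) ≤
      K * powInt w a (ball 0 (2 * ρ) \ ball 0 ρ)) :
    ∃ θ : ℝ, 0 < θ ∧ θ < 1 ∧ ∀ k : ℤ,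
      powInt w a (ball 0 (2 ^ (k + 1))) ≤ θ * powInt w a (ball 0 (2 ^ (k + 1 + 1))) := by
  refine ⟨1 - 1 / (K + 1), ?_, ?_, fun k => ?_⟩
  · rw [sub_pos, div_lt_one (by positivity)]; linarith
  · simp; positivity
  have hρ : (0 : ℝ) < 2 ^ (k + 1) := by positivity
  have h := h _ hρ
  have e : (2 : ℝ) * 2 ^ (k + 1) = 2 ^ (k + 1 + 1) := by
    rw [zpow_add_one₀ two_ne_zero (k + 1)]; ring
  rw [e] at h
  have hsub : ball (0 : EuclideanSpace ℝ (Fin d)) (2 ^ (k + 1)) ⊆ ball 0 (2 ^ (k + 1 + 1)) :=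
    ball_subset_ball (by rw [← e]; linarith)
  have hadd : powInt w a (ball 0 (2 ^ (k + 1))) +
      powInt w a (ball 0 (2 ^ (k + 1 + 1)) \ ball 0 (2 ^ (k + 1))) =
      powInt w a (ball 0 (2 ^ (k + 1 + 1))) := by
    have ht := hfin (2 ^ (k + 1 + 1)) (by positivity)
    rw [powInt, powInt, powInt, ← ENNReal.toReal_add (hfin _ hρ)
      (ne_top_of_le_ne_top ht (lintegral_mono_set Set.sdiff_subset))]
    congr 1
    rw [← lintegral_inter_add_sdiff (fun x => ENNReal.ofReal (w x) ^ a)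
      (ball (0 : EuclideanSpace ℝ (Fin d)) (2 ^ (k + 1 + 1)))
      (measurableSet_ball (x := 0) (ε := 2 ^ (k + 1))),
      Set.inter_eq_self_of_subset_right hsub]
  have n1 := powInt_nonneg w a (ball 0 (2 ^ (k + 1 + 1)) \ ball 0 (2 ^ (k + 1)))
  rw [sub_mul, one_mul, div_mul_eq_mul_div, one_mul, le_sub_iff_add_le, ← le_sub_iff_add_le',
    div_le_iff₀ (by positivity)]
  nlinarith

theorem powInt_muckenhoupt_mono {d : ℕ} {q p : ℝ} (hq : 1 < q) (hqp : q ≤ p)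
    {w : EuclideanSpace ℝ (Fin d) → ℝ} (hA : IsMuckenhoupt d q w) (hpos : ∀ᵐ x, 0 < w x) :
    ∃ C : ℝ, 0 < C ∧ ∀ (c : EuclideanSpace ℝ (Fin d)) (ρ : ℝ), 0 < ρ →
      ∫⁻ x in ball c ρ, ENNReal.ofReal (w x) ^ (-1 / (p - 1)) ≠ ⊤ ∧
      powInt w (-1 / (p - 1)) (ball c ρ) ^ (1 - 1 / p) * powInt w 1 (ball c ρ) ^ (1 / p) ≤
        C * volume.real (ball c ρ) := by
  obtain ⟨C, hC, H⟩ := muckenhoupt_powInt hq hA hpos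
  have hwm := hA.2.1.aestronglyMeasurable.aemeasurable
  have hp : 1 < p := by linarith
  have hp0 : 0 < p := by linarith
  have hp1 : 0 < p - 1 := by linarith
  have hq1 : 0 < q - 1 := by linarith
  refine ⟨C ^ (1 / p), by positivity, fun c ρ hρ => ?_⟩
  obtain ⟨hVt, H⟩ := H c ρ hρ
  set B := ball c ρ
  have hBt : volume B ≠ ⊤ := measure_ball_lt_top.ne
  have hN : 0 < volume.real B := ENNReal.toReal_pos (measure_ball_pos _ _ hρ).ne' hBt
  set t := (q - 1) / (p - 1) with ht
  have ht0 : 0 ≤ t := by positivity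
  have ht1 : t ≤ 1 := by rw [ht, div_le_one hp1]; linarith
  have e : t * (-1 / (q - 1)) + (1 - t) * 0 = -1 / (p - 1) := by
    rw [ht]; field_simp; ring
  have h0t : ∫⁻ x in B, ENNReal.ofReal (w x) ^ (0 : ℝ) ≠ ⊤ := by simpa using hBt
  have h1 := powInt_le_log_convex hwm (ae_restrict_of_ae hpos) ht0 ht1 hVt h0t
  have h2 := lintegral_rpow_le_log_convex (μ := volume.restrict B) hwm.restrict.ennreal_ofReal
    (by filter_upwards [ae_restrict_of_ae hpos] with x hx; simpa using hx) (by simp)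
    (-1 / (q - 1)) 0 ht0 ht1
  rw [e] at h1 h2
  rw [powInt_zero] at h1
  refine ⟨ne_top_of_le_ne_top (ENNReal.mul_ne_top (ENNReal.rpow_ne_top_of_nonneg ht0 hVt)
    (ENNReal.rpow_ne_top_of_nonneg (sub_nonneg.2 ht1) h0t)) h2, ?_⟩
  have nW := powInt_nonneg w 1 B
  have nU := powInt_nonneg w (-1 / (p - 1)) B
  have nV := powInt_nonneg w (-1 / (q - 1)) B
  have h3 : powInt w 1 B * powInt w (-1 / (p - 1)) B ^ (p - 1) ≤ C * volume.real B ^ p := by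
    calc _ ≤ powInt w 1 B *
          (powInt w (-1 / (q - 1)) B ^ t * volume.real B ^ (1 - t)) ^ (p - 1) := by gcongr
      _ = powInt w 1 B * powInt w (-1 / (q - 1)) B ^ (q - 1) * volume.real B ^ (p - q) := by
        rw [mul_rpow (by positivity) (by positivity), ← rpow_mul nV, ← rpow_mul hN.le,
          ← mul_assoc]
        congr 3
        · rw [ht]; field_simp
        · rw [ht]; field_simp; ring
      _ ≤ C * volume.real B ^ q * volume.real B ^ (p - q) := by gcongr
      _ = _ := by rw [mul_assoc, ← rpow_add hN]; ring_nf
  have h4 := rpow_le_rpow (by positivity) h3 (z := 1 / p) (by positivity)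
  rw [mul_rpow nW (by positivity), mul_rpow hC.le (by positivity), ← rpow_mul nU,
    ← rpow_mul hN.le, mul_one_div_cancel hp0.ne', rpow_one] at h4
  rw [mul_comm]
  convert h4 using 3
  field_simp

theorem exists_matrix_bound {d : ℕ} (hd : 0 < d) {σ s p q r : ℝ} (hq : 1 < q) (hqp : q ≤ p)
    (hr : 1 < r) (hdq : d * q ≤ p * (d + s - σ)) (hdr : d * (1 - 1 / r) = p * σ)
    {w : EuclideanSpace ℝ (Fin d) → ℝ} (hA : IsMuckenhoupt d q w) (hR : IsReverseHolder d r w)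
    (hpos : ∀ᵐ x, 0 < w x) :
    ∃ K η : ℝ, 0 < K ∧ 0 < η ∧ η < 1 ∧ ∀ j k : ℤ,
      (2 : ℝ) ^ (k * s - max j k * (d + s - 2 * σ) - j * σ - k * σ) *
        powInt w (-1 / (p - 1)) (ball 0 (2 ^ (k + 1))) ^ (1 - 1 / p) *
        powInt w 1 (ball 0 (2 ^ (j + 1))) ^ (1 / p) ≤ K * η ^ (j - k).natAbs := by
  obtain ⟨CA, hCA, HA⟩ := muckenhoupt_powInt hq hA hpos
  obtain ⟨CR, hCR, HR⟩ := reverseHolder_powInt hr hR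
  obtain ⟨CP, hCP, HP⟩ := powInt_muckenhoupt_mono hq hqp hA hpos
  obtain ⟨K, hK, HK⟩ := powInt_le_mul_powInt_annulus hd hq hr hA hR hpos
  obtain ⟨θ, hθ0, hθ1, hθ⟩ := exists_reverse_doubling hK (fun ρ hρ => (HA 0 ρ hρ).1)
    fun ρ hρ => (HK ρ hρ).1
  obtain ⟨θ', hθ0', hθ1', hθ'⟩ := exists_reverse_doubling hK (fun ρ hρ => (HR 0 ρ hρ).1)
    fun ρ hρ => (HK ρ hρ).2
  have hwm := hA.2.1.aestronglyMeasurable.aemeasurable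
  have hr0 : 0 < r := by linarith
  have hp0 : 0 < p := by linarith
  have hq1 : 0 < q - 1 := by linarith
  have hρ : ∀ k : ℤ, (0 : ℝ) < 2 ^ (k + 1) := fun k => by positivity
  have hBne : ∀ k : ℤ, volume (ball (0 : EuclideanSpace ℝ (Fin d)) (2 ^ (k + 1))) ≠ 0 :=
    fun k => (measure_ball_pos _ _ (hρ k)).ne'
  have hBt : ∀ k : ℤ, volume (ball (0 : EuclideanSpace ℝ (Fin d)) (2 ^ (k + 1))) ≠ ⊤ :=
    fun k => measure_ball_lt_top.ne
  set N : ℤ → ℝ := fun k => volume.real (ball (0 : EuclideanSpace ℝ (Fin d)) (2 ^ (k + 1)))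
  have hN : ∀ k, 0 < N k := fun k => ENNReal.toReal_pos (hBne k) (hBt k)
  set ω := volume.real (ball (0 : EuclideanSpace ℝ (Fin d)) 1) with hω
  have hωpos : 0 < ω :=
    ENNReal.toReal_pos (measure_ball_pos _ _ one_pos).ne' measure_ball_lt_top.ne
  have hNf : ∀ k : ℤ, N k = (2 ^ d * ω) * (2 : ℝ) ^ (k * (d : ℝ)) := by
    intro k
    simp only [N]
    rw [volume_real_ball_eq hd 0 (hρ k).le, zpow_add_one₀ two_ne_zero, mul_pow,
      rpow_mul two_pos.le, rpow_intCast, rpow_natCast]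
    ring
  set g : ℝ := (2 : ℝ) ^ (d : ℝ) with hg
  have hg0 : 0 < g := by positivity
  have hNg : ∀ k, N (k + 1) = g * N k := by
    intro k
    rw [hNf, hNf, hg]
    push_cast
    rw [add_mul, rpow_add two_pos, one_mul]
    ring
  have hW : ∀ k : ℤ, 0 < powInt w 1 (ball 0 (2 ^ (k + 1))) := fun k =>
    ENNReal.toReal_pos (lintegral_ball_ne_zero hwm hpos _ (hBne k))
      (lintegral_ball_ne_top hA.2.1 _ _)
  have hV : ∀ k : ℤ, 0 < powInt w (-1 / (q - 1)) (ball 0 (2 ^ (k + 1))) := fun k =>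
    ENNReal.toReal_pos (lintegral_ball_ne_zero hwm hpos _ (hBne k)) (HA _ _ (hρ k)).1
  have hRp : ∀ k : ℤ, 0 < powInt w r (ball 0 (2 ^ (k + 1))) := fun k =>
    ENNReal.toReal_pos (lintegral_ball_ne_zero hwm hpos _ (hBne k)) (HR _ _ (hρ k)).1
  have hU : ∀ k : ℤ, 0 < powInt w (-1 / (p - 1)) (ball 0 (2 ^ (k + 1))) := fun k =>
    ENNReal.toReal_pos (lintegral_ball_ne_zero hwm hpos _ (hBne k)) (HP _ _ (hρ k)).1
  have hgrow := growth_le_of_muckenhoupt hq hg0 hθ0 hCA hN hW hV hNg hθ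
    (fun k => (HA 0 _ (hρ k)).2)
    (fun k => volume_rpow_le_mul_powInt hq hwm hpos (lintegral_ball_ne_top hA.2.1 _ _)
      (HA _ _ (hρ k)).1)
  have hdec := decay_le_of_reverseHolder (e := 1 / r) (by positivity) hg0 hθ0' hN hRp hNg hθ'
    (fun k => (HR 0 _ (hρ k)).2)
    (fun k => by
      have h := powInt_le_log_convex hwm
        (ae_restrict_of_ae (s := ball (0 : EuclideanSpace ℝ (Fin d)) (2 ^ (k + 1))) hpos)
        (a := r) (b := 0) (t := 1 / r) (by positivity) (by rw [div_le_one hr0]; exact hr.le)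
        (HR _ _ (hρ k)).1 (by simpa using hBt k)
      rwa [powInt_zero, one_div_mul_cancel hr0.ne', mul_zero, add_zero] at h)
  set α := g ^ q * θ ^ (q - 1) with hα
  set β := g ^ (1 / r - 1) * θ' ^ (1 / r) with hβ
  have hα0 : 0 < α := by positivity
  have hβ0 : 0 < β := by positivity
  set η₁ := θ ^ ((q - 1) * (1 / p)) with hη₁
  set η₂ := θ' ^ (1 / r * (1 / p)) with hη₂
  have hη₁0 : 0 < η₁ := by positivity
  have hη₁1 : η₁ < 1 := rpow_lt_one hθ0.le hθ1 (by positivity)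
  have hη₂1 : η₂ < 1 := rpow_lt_one hθ0'.le hθ1' (by positivity)
  have hαη : (2 : ℝ) ^ (-(d + s - σ)) * α ^ (1 / p) ≤ max η₁ η₂ := by
    refine le_trans ?_ (le_max_left _ _)
    rw [hα, mul_rpow (by positivity) (by positivity), ← rpow_mul hθ0.le, ← hη₁, hg,
      ← rpow_mul two_pos.le, ← rpow_mul two_pos.le, ← mul_assoc, ← rpow_add two_pos]
    refine mul_le_of_le_one_left hη₁0.le (rpow_le_one_of_one_le_of_nonpos one_le_two ?_)
    have : (d : ℝ) * q * (1 / p) ≤ d + s - σ := by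
      rw [mul_one_div, div_le_iff₀ hp0]; linarith
    linarith
  have hβη : (2 : ℝ) ^ σ * β ^ (1 / p) ≤ max η₁ η₂ := by
    refine le_trans (le_of_eq ?_) (le_max_right _ _)
    rw [hβ, mul_rpow (by positivity) (by positivity), ← rpow_mul hθ0'.le, ← hη₂, hg,
      ← rpow_mul two_pos.le, ← rpow_mul two_pos.le, ← mul_assoc, ← rpow_add two_pos]
    have : σ + (d : ℝ) * (1 / r - 1) * (1 / p) = 0 := by
      have : (d : ℝ) * (1 / r - 1) = -(p * σ) := by linarith
      rw [this]; field_simp; ring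
    rw [this, rpow_zero, one_mul]
  set C := CA + CR + CP with hC
  refine ⟨C * C ^ (1 / p) * (2 ^ d * ω), max η₁ η₂, by positivity, lt_max_of_lt_left hη₁0,
    max_lt hη₁1 hη₂1, fun j k => ?_⟩
  refine matrix_entry_le (W := fun k => powInt w 1 (ball 0 (2 ^ (k + 1))))
    (U := fun k => powInt w (-1 / (p - 1)) (ball 0 (2 ^ (k + 1)))) (N := N) (C := C)
    (lt_of_lt_of_le hq hqp) (by positivity) (by positivity) hα0 hβ0 hW hU hNf ?_ ?_ ?_
    hαη hβη j k
  · intro k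
    refine ((HP 0 _ (hρ k)).2).trans ?_
    have := hN k
    change CP * N k ≤ C * N k
    gcongr
    linarith
  · intro k n
    refine (hgrow k n).trans ?_
    have := hW k
    gcongr
    linarith
  · intro k n
    refine (hdec k n).trans ?_
    have := hW (k + n)
    gcongr
    linarith

theorem iUnion_dyadic_annuli {E : Type*} [NormedAddCommGroup E] :
    ⋃ k : ℤ, (ball (0 : E) (2 ^ (k + 1)) \ ball 0 (2 ^ k)) = {0}ᶜ := by
  ext x
  simp only [Set.mem_iUnion, Set.mem_sdiff, mem_ball_zero_iff, not_lt, Set.mem_compl_iff,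
    Set.mem_singleton_iff]
  constructor
  · rintro ⟨k, -, hk⟩ rfl
    rw [norm_zero] at hk
    exact absurd hk (not_le.2 (by positivity))
  · intro hx
    obtain ⟨k, hk, hk'⟩ := exists_mem_Ico_zpow (norm_pos_iff.2 hx) one_lt_two
    exact ⟨k, hk', hk⟩

theorem lintegral_eq_tsum_dyadic_annuli {E : Type*} [NormedAddCommGroup E] [MeasurableSpace E]
    [BorelSpace E] (μ : Measure E) [NullSingletonClass μ] (F : E → ℝ≥0∞) :
    ∫⁻ x, F x ∂μ = ∑' k : ℤ, ∫⁻ x in ball (0 : E) (2 ^ (k + 1)) \ ball 0 (2 ^ k), F x ∂μ := by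
  rw [← lintegral_iUnion (fun k => measurableSet_ball.diff measurableSet_ball),
    iUnion_dyadic_annuli]
  · rw [← setLIntegral_univ]
    have h : ({0}ᶜ : Set E) =ᵐ[μ] Set.univ := ae_eq_univ.2 (by simp)
    exact (setLIntegral_congr h).symm
  · have hlt : ∀ i j : ℤ, i < j → Disjoint (ball (0 : E) (2 ^ (i + 1)) \ ball 0 (2 ^ i))
        (ball (0 : E) (2 ^ (j + 1)) \ ball 0 (2 ^ j)) := by
      intro i j hij
      refine Set.disjoint_left.2 fun x hx hx' => hx'.2 ?_
      exact ball_subset_ball (zpow_le_zpow_right₀ one_le_two (by omega)) hx.1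
    intro i j hij
    rcases lt_or_gt_of_ne hij with h | h
    · exact hlt i j h
    · exact (hlt j i h).symm

theorem kernel_le_on_annuli {σ s δ a x y : ℝ} (hσ : 0 < σ) (hs : 0 < s) (hδ : 0 < δ) (ha : 0 ≤ a)
    {j k : ℤ} (hx : (2 : ℝ) ^ j ≤ x) (hy : (2 : ℝ) ^ k ≤ y) (hy' : y < 2 ^ (k + 1)) :
    a / ((x + y) ^ δ * x ^ σ * y ^ σ) ≤
      2 ^ s * (2 : ℝ) ^ (k * s - max j k * δ - j * σ - k * σ) * (a / y ^ s) := by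
  have hj0 : (0 : ℝ) < 2 ^ j := by positivity
  have hk0 : (0 : ℝ) < 2 ^ k := by positivity
  have hx0 : 0 < x := hj0.trans_le hx
  have hy0 : 0 < y := hk0.trans_le hy
  have h1 : (2 : ℝ) ^ (((max j k : ℤ) : ℝ) * δ) ≤ (x + y) ^ δ := by
    rw [rpow_mul two_pos.le, rpow_intCast]
    gcongr
    rcases max_choice j k with h | h <;> rw [h] <;> linarith
  have h2 : (2 : ℝ) ^ ((j : ℝ) * σ) ≤ x ^ σ := by
    rw [rpow_mul two_pos.le, rpow_intCast]; gcongr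
  have h3 : (2 : ℝ) ^ ((k : ℝ) * σ) ≤ y ^ σ := by
    rw [rpow_mul two_pos.le, rpow_intCast]; gcongr
  have h4 : y ^ s ≤ 2 ^ s * (2 : ℝ) ^ ((k : ℝ) * s) := by
    rw [rpow_mul two_pos.le, rpow_intCast, ← mul_rpow two_pos.le hk0.le, mul_comm,
      ← zpow_add_one₀ two_ne_zero]
    gcongr
  calc a / ((x + y) ^ δ * x ^ σ * y ^ σ)
      = y ^ s / ((x + y) ^ δ * x ^ σ * y ^ σ) * (a / y ^ s) := by field_simp
    _ ≤ (2 ^ s * (2 : ℝ) ^ ((k : ℝ) * s)) / ((2 : ℝ) ^ (((max j k : ℤ) : ℝ) * δ) *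
          (2 : ℝ) ^ ((j : ℝ) * σ) * (2 : ℝ) ^ ((k : ℝ) * σ)) * (a / y ^ s) := by gcongr
    _ = _ := by
      rw [rpow_sub two_pos, rpow_sub two_pos, rpow_sub two_pos]
      push_cast
      field_simp

theorem setLIntegral_le_holder_weight {α : Type*} [MeasurableSpace α] {μ : Measure α}
    {g W : α → ℝ≥0∞} {p : ℝ} (hp : 1 < p) (hg : AEMeasurable g μ) (hW : AEMeasurable W μ)
    (h0 : ∀ᵐ x ∂μ, W x ≠ 0) (ht : ∀ᵐ x ∂μ, W x ≠ ⊤) :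
    ∫⁻ x, g x ∂μ ≤ (∫⁻ x, g x ^ p * W x ∂μ) ^ (1 / p) *
      (∫⁻ x, W x ^ (-1 / (p - 1)) ∂μ) ^ (1 - 1 / p) := by
  have hp0 : 0 < p := by linarith
  have hp1 : p - 1 ≠ 0 := by linarith
  have hp2 : 0 ≤ 1 - 1 / p := by rw [sub_nonneg, div_le_one hp0]; exact hp.le
  refine le_trans (le_of_eq (lintegral_congr_ae ?_)) (ENNReal.lintegral_mul_norm_pow_le
    ((hg.pow_const p).mul hW) (hW.pow_const _) (by positivity) hp2 (by ring))
  filter_upwards [h0, ht] with x hx hx'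
  rw [Pi.mul_apply, ENNReal.mul_rpow_of_nonneg _ _ (by positivity), ← ENNReal.rpow_mul,
    ← ENNReal.rpow_mul, mul_one_div_cancel hp0.ne', ENNReal.rpow_one, mul_assoc,
    ← ENNReal.rpow_add _ _ hx hx']
  have e : 1 / p + -1 / (p - 1) * (1 - 1 / p) = 0 := by field_simp; ring
  rw [e, ENNReal.rpow_zero, mul_one]

theorem exists_toeplitz_sum_bound {K η : ℝ} (hK : 0 < K) (h0 : 0 ≤ η) (h1 : η < 1) :
    ∃ M : ℝ, 0 < M ∧
      (∀ j : ℤ, ∑' k : ℤ, ENNReal.ofReal (K * η ^ (j - k).natAbs) ≤ ENNReal.ofReal M) ∧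
      ∀ k : ℤ, ∑' j : ℤ, ENNReal.ofReal (K * η ^ (j - k).natAbs) ≤ ENNReal.ofReal M := by
  obtain ⟨M, hM, H⟩ := exists_tsum_pow_natAbs_le h0 h1
  refine ⟨K * M, by positivity, fun j => ?_, fun k => ?_⟩ <;>
    simp only [ENNReal.ofReal_mul hK.le, ENNReal.tsum_mul_left] <;> gcongr
  · exact ((Equiv.subLeft j).tsum_eq fun k : ℤ => ENNReal.ofReal (η ^ k.natAbs)).trans_le H
  · exact ((Equiv.subRight k).tsum_eq fun k : ℤ => ENNReal.ofReal (η ^ k.natAbs)).trans_le H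

theorem stmt13 (d : ℕ) (hd : 3 ≤ d) (σ s p : ℝ) (hσ : 0 < σ) (hs : 0 < s)
    (h2σ : 0 < (d : ℝ) + s - 2 * σ) (hσd : σ < d)
    (hp1 : max 1 ((d : ℝ) / ((d : ℝ) + s - σ)) < p) (hp2 : p < (d : ℝ) / σ)
    (w : EuclideanSpace ℝ (Fin d) → ℝ)
    (hwA : IsMuckenhoupt d (p / max 1 ((d : ℝ) / ((d : ℝ) + s - σ))) w)
    (hwRH : IsReverseHolder d
      (((d : ℝ) / σ / p) / ((d : ℝ) / σ / p - 1)) w) :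
    ∃ C : ℝ, 0 < C ∧ ∀ f : EuclideanSpace ℝ (Fin d) → ℂ, Measurable f →
      (∫⁻ x, (∫⁻ y, ENNReal.ofReal
            (‖f y‖ / ((‖x‖ + ‖y‖) ^ ((d : ℝ) + s - 2 * σ) * ‖x‖ ^ σ * ‖y‖ ^ σ))) ^ p *
          ENNReal.ofReal (w x)) ^ (1 / p) ≤
        ENNReal.ofReal C *
          (∫⁻ x, ENNReal.ofReal (‖f x‖ / ‖x‖ ^ s) ^ p * ENNReal.ofReal (w x)) ^ (1 / p) := by
  have hd0 : 0 < d := by omega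
  have hD : (0 : ℝ) < d := by exact_mod_cast hd0
  have : Nonempty (Fin d) := ⟨⟨0, hd0⟩⟩
  have hp : 1 < p := (le_max_left _ _).trans_lt hp1
  have hp0 : 0 < p := by linarith
  have hDs : 0 < (d : ℝ) + s - σ := by linarith
  set m := max 1 ((d : ℝ) / ((d : ℝ) + s - σ)) with hm
  have hm1 : 1 ≤ m := le_max_left _ _
  have hm0 : 0 < m := by linarith
  set t := (d : ℝ) / σ / p with ht
  have ht1 : 1 < t := by rwa [ht, one_lt_div hp0]
  have hr : 1 < t / (t - 1) := by rw [one_lt_div (by linarith)]; linarith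
  have hdr : (d : ℝ) * (1 - 1 / (t / (t - 1))) = p * σ := by
    have e : 1 - 1 / (t / (t - 1)) = 1 / t := by
      have : t - 1 ≠ 0 := by linarith
      field_simp
      ring
    rw [e, ht]
    field_simp
  have hdq : (d : ℝ) * (p / m) ≤ p * (d + s - σ) := by
    have : (d : ℝ) / m ≤ d + s - σ := by
      rw [div_le_comm₀ hm0 hDs]; exact le_max_right _ _
    calc (d : ℝ) * (p / m) = p * (d / m) := by ring
      _ ≤ _ := by gcongr
  rcases ae_eq_zero_or_ae_pos_of_reverseHolder hd0 hr hwRH with hzero | hpos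
  · refine ⟨1, one_pos, fun f hf => ?_⟩
    have : ∫⁻ x, (∫⁻ y, ENNReal.ofReal
            (‖f y‖ / ((‖x‖ + ‖y‖) ^ ((d : ℝ) + s - 2 * σ) * ‖x‖ ^ σ * ‖y‖ ^ σ))) ^ p *
          ENNReal.ofReal (w x) = 0 := by
      refine (lintegral_congr_ae ?_).trans lintegral_zero
      filter_upwards [hzero] with x hx
      simp [hx]
    rw [this, ENNReal.zero_rpow_of_pos (by positivity)]
    exact zero_le
  have hwm := hwA.2.1.aestronglyMeasurable.aemeasurable
  have hWm : AEMeasurable (fun x => ENNReal.ofReal (w x)) := hwm.ennreal_ofReal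
  have hq1 : 1 < p / m := by rwa [one_lt_div hm0]
  have hqp : p / m ≤ p := div_le_self hp0.le hm1
  obtain ⟨K, η, hK, hη0, hη1, hmat⟩ := exists_matrix_bound hd0 (s := s) hq1 hqp hr hdq hdr hwA hwRH
    hpos
  obtain ⟨CP, -, HP⟩ := powInt_muckenhoupt_mono hq1 hqp hwA hpos
  obtain ⟨M, hM, hrow, hcol⟩ := exists_toeplitz_sum_bound (K := 2 ^ s * K) (by positivity)
    hη0.le hη1
  refine ⟨M, hM, fun f hf => ?_⟩
  set g : EuclideanSpace ℝ (Fin d) → ℝ≥0∞ := fun x => ENNReal.ofReal (‖f x‖ / ‖x‖ ^ s) with hg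
  have hgm : Measurable g := by fun_prop
  set B : ℤ → Set (EuclideanSpace ℝ (Fin d)) := fun k => ball 0 (2 ^ (k + 1)) with hB
  set A : ℤ → Set (EuclideanSpace ℝ (Fin d)) := fun k => ball 0 (2 ^ (k + 1)) \ ball 0 (2 ^ k)
    with hA
  have hAB : ∀ k, A k ⊆ B k := fun k => Set.sdiff_subset
  have hAm : ∀ k, MeasurableSet (A k) := fun k => measurableSet_ball.diff measurableSet_ball
  set b : ℤ → ℝ≥0∞ := fun k => (∫⁻ x in A k, g x ^ p * ENNReal.ofReal (w x)) ^ (1 / p) with hb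
  set U : ℤ → ℝ := fun k => powInt w (-1 / (p - 1)) (B k) with hU
  set W : ℤ → ℝ := fun k => powInt w 1 (B k) with hW
  have hp2 : 0 ≤ 1 - 1 / p := by rw [sub_nonneg, div_le_one hp0]; exact hp.le
  have hgA : ∀ k, ∫⁻ y in A k, g y ≤ ENNReal.ofReal (U k ^ (1 - 1 / p)) * b k := by
    intro k
    have hUt : ∫⁻ x in B k, ENNReal.ofReal (w x) ^ (-1 / (p - 1)) ≠ ⊤ :=
      (HP 0 _ (by positivity)).1
    have h := setLIntegral_le_holder_weight (μ := volume.restrict (A k)) hp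
      hgm.aemeasurable hWm.restrict
      (by filter_upwards [ae_restrict_of_ae hpos] with x hx; simpa using hx) (by simp)
    rw [mul_comm]
    refine h.trans ?_
    rw [← ENNReal.ofReal_rpow_of_nonneg (powInt_nonneg _ _ _) hp2]
    simp only [powInt]
    rw [ENNReal.ofReal_toReal hUt]
    gcongr
    exact hAB k
  set κ : ℤ → ℤ → ℝ := fun j k =>
    2 ^ s * (2 : ℝ) ^ (k * s - max j k * ((d : ℝ) + s - 2 * σ) - j * σ - k * σ) with hκ
  have hκ0 : ∀ j k, 0 ≤ κ j k := fun j k => by positivity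
  have hU0 : ∀ k, 0 ≤ U k := fun k => powInt_nonneg _ _ _
  have hW0 : ∀ k, 0 ≤ W k := fun k => powInt_nonneg _ _ _
  have hinner : ∀ j, ∀ x ∈ A j, ∫⁻ y, ENNReal.ofReal
      (‖f y‖ / ((‖x‖ + ‖y‖) ^ ((d : ℝ) + s - 2 * σ) * ‖x‖ ^ σ * ‖y‖ ^ σ)) ≤
      ∑' k, ENNReal.ofReal (κ j k * U k ^ (1 - 1 / p)) * b k := by
    intro j x hx
    rw [lintegral_eq_tsum_dyadic_annuli]
    refine ENNReal.tsum_le_tsum fun k => ?_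
    calc ∫⁻ y in A k, ENNReal.ofReal
          (‖f y‖ / ((‖x‖ + ‖y‖) ^ ((d : ℝ) + s - 2 * σ) * ‖x‖ ^ σ * ‖y‖ ^ σ))
        ≤ ∫⁻ y in A k, ENNReal.ofReal (κ j k) * g y := by
          refine setLIntegral_mono' (hAm k) fun y hy => ?_
          rw [hg, ← ENNReal.ofReal_mul (hκ0 j k)]
          refine ENNReal.ofReal_le_ofReal (kernel_le_on_annuli hσ hs h2σ (norm_nonneg _) ?_ ?_ ?_)
          · simpa [hA] using hx.2
          · simpa [hA] using hy.2
          · simpa [hA] using hy.1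
      _ = ENNReal.ofReal (κ j k) * ∫⁻ y in A k, g y := lintegral_const_mul _ hgm
      _ ≤ ENNReal.ofReal (κ j k) * (ENNReal.ofReal (U k ^ (1 - 1 / p)) * b k) := by
          gcongr; exact hgA k
      _ = _ := by rw [ENNReal.ofReal_mul (hκ0 j k), mul_assoc]
  have houter : ∀ j, ∫⁻ x in A j, (∫⁻ y, ENNReal.ofReal
      (‖f y‖ / ((‖x‖ + ‖y‖) ^ ((d : ℝ) + s - 2 * σ) * ‖x‖ ^ σ * ‖y‖ ^ σ))) ^ p *
        ENNReal.ofReal (w x) ≤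
      (∑' k, ENNReal.ofReal (2 ^ s * K * η ^ (j - k).natAbs) * b k) ^ p := by
    intro j
    have hWj : ∫⁻ x in B j, ENNReal.ofReal (w x) = ENNReal.ofReal (W j ^ (1 / p)) ^ p := by
      rw [ENNReal.ofReal_rpow_of_nonneg (by have := hW0 j; positivity) hp0.le, ← rpow_mul (hW0 j),
        one_div_mul_cancel hp0.ne', rpow_one]
      simp only [hW, powInt]
      rw [ENNReal.ofReal_toReal (lintegral_ball_ne_top hwA.2.1 _ _)]
      simp [hB]
    calc _ ≤ ∫⁻ x in A j, (∑' k, ENNReal.ofReal (κ j k * U k ^ (1 - 1 / p)) * b k) ^ p *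
          ENNReal.ofReal (w x) := by
          refine setLIntegral_mono' (hAm j) fun x hx => ?_
          gcongr
          exact hinner j x hx
      _ = (∑' k, ENNReal.ofReal (κ j k * U k ^ (1 - 1 / p)) * b k) ^ p *
          ∫⁻ x in A j, ENNReal.ofReal (w x) := lintegral_const_mul'' _ hWm.restrict
      _ ≤ (∑' k, ENNReal.ofReal (κ j k * U k ^ (1 - 1 / p)) * b k) ^ p *
          ∫⁻ x in B j, ENNReal.ofReal (w x) := by
          gcongr; exact hAB j
      _ = (∑' k, ENNReal.ofReal (κ j k * U k ^ (1 - 1 / p) * W j ^ (1 / p)) * b k) ^ p := by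
          rw [hWj, ← ENNReal.mul_rpow_of_nonneg _ _ hp0.le, ← ENNReal.tsum_mul_right]
          congr 2
          funext k
          rw [ENNReal.ofReal_mul (p := κ j k * U k ^ (1 - 1 / p))
            (mul_nonneg (hκ0 j k) (rpow_nonneg (hU0 k) _)), mul_right_comm]
      _ ≤ _ := by
          refine ENNReal.rpow_le_rpow (ENNReal.tsum_le_tsum fun k =>
            mul_le_mul_left (ENNReal.ofReal_le_ofReal ?_) _) hp0.le
          have h := mul_le_mul_of_nonneg_left (hmat j k) (by positivity : (0 : ℝ) ≤ 2 ^ s)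
          calc κ j k * U k ^ (1 - 1 / p) * W j ^ (1 / p) = _ := by
                simp only [hκ, mul_assoc]; rfl
            _ ≤ _ := h
            _ = _ := by ring
  have hbp : ∀ k, b k ^ p = ∫⁻ x in A k, g x ^ p * ENNReal.ofReal (w x) := by
    intro k
    simp only [hb]
    rw [← ENNReal.rpow_mul, one_div_mul_cancel hp0.ne', ENNReal.rpow_one]
  have hfinal : ∫⁻ x, (∫⁻ y, ENNReal.ofReal
      (‖f y‖ / ((‖x‖ + ‖y‖) ^ ((d : ℝ) + s - 2 * σ) * ‖x‖ ^ σ * ‖y‖ ^ σ))) ^ p *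
        ENNReal.ofReal (w x) ≤
      ENNReal.ofReal M ^ p * ∫⁻ x, g x ^ p * ENNReal.ofReal (w x) := by
    rw [lintegral_eq_tsum_dyadic_annuli volume fun x => g x ^ p * ENNReal.ofReal (w x),
      lintegral_eq_tsum_dyadic_annuli]
    calc _ ≤ ∑' j, (∑' k, ENNReal.ofReal (2 ^ s * K * η ^ (j - k).natAbs) * b k) ^ p :=
          ENNReal.tsum_le_tsum houter
      _ ≤ ENNReal.ofReal M ^ p * ∑' k, b k ^ p := tsum_rpow_le_of_schur hp hrow hcol b
      _ = _ := by simp only [hbp, hA]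
  calc _ ≤ (ENNReal.ofReal M ^ p * ∫⁻ x, g x ^ p * ENNReal.ofReal (w x)) ^ (1 / p) := by
        gcongr
    _ = _ := by
        rw [ENNReal.mul_rpow_of_nonneg _ _ (by positivity), ← ENNReal.rpow_mul,
          mul_one_div_cancel hp0.ne', ENNReal.rpow_one]
end

section
/- Let d ≥ 1 be an integer, let 1 < p₀ < p < q₀ < ∞, and let w be a weight on ℝ^d. Then w ∈ A_{p/p₀} ∩ RH_{(q₀/p)'} if and only if w^{1−p'} ∈ A_{p'/q₀'} ∩ RH_{(p₀'/p')'}, where for any exponent r ∈ (1,∞), r' = r/(r−1) denotes its conjugate exponent. -/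
open MeasureTheory Metric Real
open scoped ENNReal

/-- The Hölder conjugate exponent `r' = r/(r-1)`. -/
noncomputable def conjExp (r : ℝ) : ℝ := r / (r - 1)

open Filter Topology in
/-- If every ball either misses `F` up to a null set or meets it in at least a fixed proportion of
its measure, then `F` is null or conull. -/
theorem measure_eq_zero_or_measure_compl_eq_zero_of_ball {E : Type*} [NormedAddCommGroup E]
    [NormedSpace ℝ E] [FiniteDimensional ℝ E] [MeasurableSpace E] [BorelSpace E]
    (μ : Measure E) [μ.IsAddHaarMeasure] {F : Set E} (hF : NullMeasurableSet F μ)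
    {c : ℝ≥0∞} (hc : c ≠ 0)
    (h : ∀ x r, 0 < r → μ (F ∩ ball x r) = 0 ∨ c * μ (ball x r) ≤ μ (F ∩ ball x r)) :
    μ F = 0 ∨ μ Fᶜ = 0 := by
  refine or_iff_not_imp_right.2 fun hFc => ?_
  have h1c : (1 : ℝ≥0∞) < 1 + c := ENNReal.lt_add_right ENNReal.one_ne_top hc
  -- a density point of the complement is the centre of a small ball missing `F`
  obtain ⟨x, hx⟩ : ∃ x, Tendsto (fun r => μ (Fᶜ ∩ closedBall x r) / μ (closedBall x r))
      (𝓝[>] 0) (𝓝 1) := by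
    have : (ae (μ.restrict Fᶜ)).NeBot := by
      rw [ae_neBot, Ne, Measure.restrict_eq_zero]
      exact hFc
    exact (Besicovitch.ae_tendsto_measure_inter_div μ Fᶜ).exists
  obtain ⟨r, hr, hr0⟩ : ∃ r, 0 < r ∧ μ (F ∩ ball x r) = 0 := by
    have hev : ∀ᶠ r in 𝓝[>] (0 : ℝ),
        1 < μ (Fᶜ ∩ closedBall x r) / μ (closedBall x r) + c :=
      (hx.add_const c).eventually (lt_mem_nhds h1c)
    obtain ⟨r, hr1, hr⟩ := (hev.and self_mem_nhdsWithin).exists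
    have hr : 0 < r := hr
    refine ⟨r, hr, (h x r hr).resolve_right fun hcr => ?_⟩
    have hV0 : μ (closedBall x r) ≠ 0 := (measure_closedBall_pos μ x hr).ne'
    have hVt : μ (closedBall x r) ≠ ∞ := measure_closedBall_lt_top.ne
    have hVb : μ (ball x r) = μ (closedBall x r) := by
      rw [Measure.addHaar_closedBall μ x hr.le, Measure.addHaar_ball_of_pos μ x hr]
    have hsum : μ (Fᶜ ∩ closedBall x r) + c * μ (closedBall x r) ≤ μ (closedBall x r) := by
      calc μ (Fᶜ ∩ closedBall x r) + c * μ (closedBall x r)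
          ≤ μ (Fᶜ ∩ closedBall x r) + μ (F ∩ closedBall x r) := by
            rw [← hVb]
            gcongr
            exact hcr.trans (measure_mono (Set.inter_subset_inter_right _ ball_subset_closedBall))
        _ = μ (closedBall x r) := by
            rw [Set.inter_comm, Set.inter_comm F, add_comm, ← Set.sdiff_eq]
            exact measure_inter_add_sdiff₀ _ hF
    have := ENNReal.div_le_of_le_mul (hsum.trans_eq (one_mul _).symm)
    rw [ENNReal.add_div, ENNReal.mul_div_cancel_right hV0 hVt] at this
    exact (hr1.trans_le this).false
  -- the dilation factor by which such a ball can be enlarged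
  obtain ⟨l, hl, hl1⟩ : ∃ l : ℝ, ENNReal.ofReal (l ^ Module.finrank ℝ E) < 1 + c ∧ 1 < l := by
    have ht : Tendsto (fun l : ℝ => ENNReal.ofReal (l ^ Module.finrank ℝ E)) (𝓝[>] 1) (𝓝 1) := by
      have : Continuous fun l : ℝ => ENNReal.ofReal (l ^ Module.finrank ℝ E) :=
        ENNReal.continuous_ofReal.comp (continuous_pow _)
      simpa using (this.tendsto 1).mono_left nhdsWithin_le_nhds
    exact ((ht.eventually (gt_mem_nhds h1c)).and self_mem_nhdsWithin).exists
  have hl0 : 0 < l := one_pos.trans hl1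
  have step : ∀ ρ, 0 < ρ → μ (F ∩ ball x ρ) = 0 → μ (F ∩ ball x (l * ρ)) = 0 := by
    intro ρ hρ h0
    refine (h x (l * ρ) (by positivity)).resolve_right fun hcr => ?_
    have hV0 : μ (ball x ρ) ≠ 0 := (measure_ball_pos μ x hρ).ne'
    have hVt : μ (ball x ρ) ≠ ∞ := measure_ball_lt_top.ne
    set L := ENNReal.ofReal (l ^ Module.finrank ℝ E) with hL
    have hVl : μ (ball x (l * ρ)) = L * μ (ball x ρ) := by
      rw [Measure.addHaar_ball_mul_of_pos μ x hl0, Measure.addHaar_ball_center μ x]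
    have hL1 : 1 ≤ L := by
      rw [hL, ENNReal.one_le_ofReal]
      exact one_le_pow₀ hl1.le
    have hsub : μ (F ∩ ball x (l * ρ)) ≤ μ (ball x (l * ρ) \ ball x ρ) := by
      refine (measure_mono (t := (F ∩ ball x ρ) ∪ (ball x (l * ρ) \ ball x ρ)) ?_).trans
        ((measure_union_le _ _).trans (by rw [h0, zero_add]))
      intro y hy
      by_cases hyb : y ∈ ball x ρ
      · exact Or.inl ⟨hy.1, hyb⟩
      · exact Or.inr ⟨hy.2, hyb⟩
    have hsum : μ (ball x ρ) + c * μ (ball x (l * ρ)) ≤ μ (ball x (l * ρ)) := by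
      refine (add_le_add_right (hcr.trans hsub) _).trans ?_
      have hbb : ball x ρ ⊆ ball x (l * ρ) := ball_subset_ball (by nlinarith)
      rw [measure_sdiff hbb measurableSet_ball.nullMeasurableSet hVt,
        add_tsub_cancel_of_le (measure_mono hbb)]
    rw [hVl, ← mul_assoc] at hsum
    have hsum' : (1 + c * L) * μ (ball x ρ) ≤ L * μ (ball x ρ) := by
      rwa [add_mul, one_mul]
    rw [ENNReal.mul_le_mul_iff_left hV0 hVt] at hsum'
    exact (hl.trans_le ((add_le_add_right (le_mul_of_one_le_right' hL1) 1).trans hsum')).false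
  have hpow : ∀ n : ℕ, μ (F ∩ ball x (l ^ n * r)) = 0 := by
    intro n
    induction n with
    | zero => simpa using hr0
    | succ n ih =>
      rw [pow_succ', mul_assoc]
      exact step _ (by positivity) ih
  have hcover : F ⊆ ⋃ n : ℕ, F ∩ ball x (l ^ n * r) := by
    intro y hy
    obtain ⟨n, hn⟩ := pow_unbounded_of_one_lt (dist y x / r) hl1
    exact Set.mem_iUnion.2 ⟨n, hy, by rwa [mem_ball, ← div_lt_iff₀ hr]⟩
  exact measure_mono_null hcover (measure_iUnion_null hpow)

section ProbabilityMeasure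

variable {α : Type*} [MeasurableSpace α] {μ : Measure α} [IsProbabilityMeasure μ] {f u : α → ℝ≥0∞}

theorem lintegral_rpow_le_rpow_lintegral (hf : AEMeasurable f μ) {θ : ℝ} (h0 : 0 ≤ θ)
    (h1 : θ ≤ 1) : ∫⁻ x, f x ^ θ ∂μ ≤ (∫⁻ x, f x ∂μ) ^ θ := by
  simpa using ENNReal.lintegral_mul_norm_pow_le (g := fun _ => 1) hf aemeasurable_const h0
    (sub_nonneg.2 h1) (add_sub_cancel θ 1)

theorem one_le_rpow_lintegral_rpow_mul_lintegral_rpow_neg (hu : AEMeasurable u μ)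
    (h0 : ∀ᵐ x ∂μ, u x ≠ 0) (htop : ∀ᵐ x ∂μ, u x ≠ ∞) {s a : ℝ} (hs : 0 < s) (ha : 0 < a) :
    1 ≤ (∫⁻ x, u x ^ s ∂μ) ^ (a / s) * ∫⁻ x, u x ^ (-a) ∂μ := by
  have hsa : 0 < a + s := by positivity
  have key : (1 : ℝ≥0∞) ≤ (∫⁻ x, u x ^ s ∂μ) ^ (a / (a + s)) *
      (∫⁻ x, u x ^ (-a) ∂μ) ^ (s / (a + s)) := by
    calc (1 : ℝ≥0∞) = ∫⁻ _, 1 ∂μ := by simp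
      _ = ∫⁻ x, (u x ^ s) ^ (a / (a + s)) * (u x ^ (-a)) ^ (s / (a + s)) ∂μ := by
        refine lintegral_congr_ae ?_
        filter_upwards [h0, htop] with x hx0 hxt
        rw [← ENNReal.rpow_mul, ← ENNReal.rpow_mul, ← ENNReal.rpow_add _ _ hx0 hxt,
          show s * (a / (a + s)) + -a * (s / (a + s)) = 0 by ring, ENNReal.rpow_zero]
      _ ≤ _ := ENNReal.lintegral_mul_norm_pow_le (hu.pow_const _) (hu.pow_const _)
        (by positivity) (by positivity) (by field_simp)
  have hpos : 0 < (a + s) / s := by positivity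
  have := ENNReal.rpow_le_rpow key hpos.le
  rwa [ENNReal.one_rpow, ENNReal.mul_rpow_of_nonneg _ _ hpos.le, ← ENNReal.rpow_mul,
    ← ENNReal.rpow_mul, show a / (a + s) * ((a + s) / s) = a / s by field_simp,
    show s / (a + s) * ((a + s) / s) = 1 by field_simp, ENNReal.rpow_one] at this

end ProbabilityMeasure

section Weights

variable {d : ℕ} {w : EuclideanSpace ℝ (Fin d) → ℝ}

theorem ballAvg_eq_lintegral_cond (B : Set (EuclideanSpace ℝ (Fin d)))
    (g : EuclideanSpace ℝ (Fin d) → ℝ) :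
    ballAvg B g = ∫⁻ x, ENNReal.ofReal (g x) ∂(ProbabilityTheory.cond volume B) := by
  rw [ballAvg, ProbabilityTheory.cond, lintegral_smul_measure, smul_eq_mul, mul_comm,
    div_eq_mul_inv]

theorem isProbabilityMeasure_cond_ball (c : EuclideanSpace ℝ (Fin d)) {r : ℝ} (hr : 0 < r) :
    IsProbabilityMeasure (ProbabilityTheory.cond volume (ball c r)) :=
  ProbabilityTheory.cond_isProbabilityMeasure_of_finite (measure_ball_pos _ _ hr).ne'
    measure_ball_lt_top.ne

theorem cond_ball_absolutelyContinuous (c : EuclideanSpace ℝ (Fin d)) (r : ℝ) :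
    ProbabilityTheory.cond volume (ball c r) ≪ volume :=
  Measure.smul_absolutelyContinuous.trans Measure.restrict_le_self.absolutelyContinuous

theorem ballAvg_eq_zero_of_ae_eq_zero {g : EuclideanSpace ℝ (Fin d) → ℝ} (hg : g =ᵐ[volume] 0)
    (B : Set (EuclideanSpace ℝ (Fin d))) : ballAvg B g = 0 := by
  have : ∫⁻ x in B, ENNReal.ofReal (g x) = ∫⁻ _ in B, 0 :=
    lintegral_congr_ae <| ae_restrict_of_ae <| hg.mono fun x hx => by simp [hx]
  simp [ballAvg, this]

theorem ballAvg_ne_top (hw : LocallyIntegrable w) (c : EuclideanSpace ℝ (Fin d)) {r : ℝ}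
    (hr : 0 < r) : ballAvg (ball c r) w ≠ ∞ := by
  have hint : IntegrableOn w (ball c r) :=
    (hw.integrableOn_isCompact (isCompact_closedBall c r)).mono_set ball_subset_closedBall
  exact ENNReal.div_ne_top hint.lintegral_lt_top.ne (measure_ball_pos _ _ hr).ne'

theorem locallyIntegrable_of_ballAvg_ne_top {g : EuclideanSpace ℝ (Fin d) → ℝ}
    (hg : AEStronglyMeasurable g) (hg0 : ∀ x, 0 ≤ g x)
    (h : ∀ (c : EuclideanSpace ℝ (Fin d)) (r : ℝ), 0 < r → ballAvg (ball c r) g ≠ ∞) :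
    LocallyIntegrable g := by
  intro x
  refine ⟨ball x 1, ball_mem_nhds x one_pos, hg.restrict, ?_⟩
  rw [hasFiniteIntegral_iff_ofReal (.of_forall hg0), lt_top_iff_ne_top]
  intro htop
  apply h x 1 one_pos
  rw [ballAvg, htop, ENNReal.top_div_of_ne_top measure_ball_lt_top.ne]

/-- A weight in a reverse Hölder class is either a.e. zero or a.e. positive. -/
theorem IsReverseHolder.ae_eq_zero_or_ae_pos {s : ℝ} (hs : 1 < s) (h : IsReverseHolder d s w) :
    w =ᵐ[volume] 0 ∨ ∀ᵐ x, 0 < w x := by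
  obtain ⟨hw0, hwi, C, -, hC⟩ := h
  have hs0 : 0 < s := one_pos.trans hs
  have hwm : AEMeasurable w := hwi.aestronglyMeasurable.aemeasurable
  set F : Set (EuclideanSpace ℝ (Fin d)) := {x | w x ≠ 0} with hF
  have hFm : NullMeasurableSet F := hwm.nullMeasurable (measurableSet_singleton 0).compl
  set θ : ℝ := 1 - 1 / s with hθ
  have hθ0 : 0 < θ := by
    rw [hθ, sub_pos, div_lt_one hs0]
    exact hs
  have hdich := measure_eq_zero_or_measure_compl_eq_zero_of_ball volume hFm
    (c := (ENNReal.ofReal C)⁻¹ ^ (1 / θ))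
    (by simp [ENNReal.rpow_eq_zero_iff, hθ0, hθ0.le]) ?_
  · refine hdich.imp (fun h0 => ?_) fun h0 => ?_
    · exact measure_eq_zero_iff_ae_notMem.1 h0 |>.mono fun x hx => by simpa [hF] using hx
    · refine measure_eq_zero_iff_ae_notMem.1 h0 |>.mono fun x hx => (hw0 x).lt_of_ne' ?_
      simpa [hF] using hx
  intro c r hr
  have := isProbabilityMeasure_cond_ball c hr
  have hV0 : volume (ball c r) ≠ 0 := (measure_ball_pos _ _ hr).ne'
  have hVt : volume (ball c r) ≠ ∞ := measure_ball_lt_top.ne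
  have hac := cond_ball_absolutelyContinuous c r
  set ν := ProbabilityTheory.cond volume (ball c r) with hν
  have hνF : ν F = (volume (ball c r))⁻¹ * volume (F ∩ ball c r) := by
    rw [hν, ProbabilityTheory.cond_apply measurableSet_ball, Set.inter_comm]
  have hum : AEMeasurable (fun x => ENNReal.ofReal (w x)) ν := hwm.ennreal_ofReal.mono_ac hac
  have hFν : NullMeasurableSet F ν := hFm.mono_ac hac
  by_cases hI : ballAvg (ball c r) w = 0
  · left
    rw [ballAvg_eq_lintegral_cond, lintegral_eq_zero_iff' hum] at hI
    have : ν F = 0 := measure_eq_zero_iff_ae_notMem.2 <| hI.mono fun x hx => by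
      simpa [hF] using (ENNReal.ofReal_eq_zero.1 hx).antisymm (hw0 x)
    simpa [hνF, hVt] using this
  right
  have hle : ballAvg (ball c r) w ≤ (ballAvg (ball c r) fun x => w x ^ s) ^ (1 / s) * ν F ^ θ := by
    rw [ballAvg_eq_lintegral_cond, ballAvg_eq_lintegral_cond, ← hν]
    calc ∫⁻ x, ENNReal.ofReal (w x) ∂ν
        = ∫⁻ x, ENNReal.ofReal (w x ^ s) ^ (1 / s) * (F.indicator 1 x) ^ θ ∂ν := by
          refine lintegral_congr fun x => ?_
          rw [← ENNReal.ofReal_rpow_of_nonneg (hw0 x) hs0.le, ← ENNReal.rpow_mul,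
            mul_one_div_cancel hs0.ne', ENNReal.rpow_one]
          by_cases hx : x ∈ F
          · simp [hx]
          · have : w x = 0 := by simpa [hF] using hx
            simp [this]
      _ ≤ (∫⁻ x, ENNReal.ofReal (w x ^ s) ∂ν) ^ (1 / s) * (∫⁻ x, F.indicator 1 x ∂ν) ^ θ :=
          ENNReal.lintegral_mul_norm_pow_le ((hwm.mono_ac hac).pow_const s).ennreal_ofReal
            (aemeasurable_one.indicator₀ hFν) (by positivity) hθ0.le (by rw [hθ]; ring)
      _ = _ := by rw [lintegral_indicator_one₀ hFν]
  have h1 : 1 ≤ ENNReal.ofReal C * ν F ^ θ := by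
    rw [← ENNReal.mul_le_mul_iff_left hI (ballAvg_ne_top hwi c hr), one_mul, mul_right_comm]
    exact hle.trans (mul_le_mul_left (hC c r hr) _)
  have h2 : (ENNReal.ofReal C)⁻¹ ≤ ν F ^ θ := by
    rw [ENNReal.inv_le_iff_le_mul (fun _ hC0 => by simp [hC0] at h1)
      (fun h => absurd h ENNReal.ofReal_ne_top)]
    exact h1
  have h3 : (ENNReal.ofReal C)⁻¹ ^ (1 / θ) ≤ ν F := by
    rw [one_div, ENNReal.rpow_inv_le_iff hθ0]
    exact h2
  calc _ ≤ ν F * volume (ball c r) := mul_le_mul_left h3 _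
    _ = volume (F ∩ ball c r) := by
      rw [hνF, mul_right_comm, ENNReal.inv_mul_cancel hV0 hVt, one_mul]

/-- Passing from `w` to `w ^ (-a)` exchanges the roles of the exponents `s` and `t` in
`A_{1 + 1/t} ∩ RH_s`. -/
theorem IsMuckenhoupt.rpow_neg_of_isReverseHolder {s t a : ℝ} (hs : 1 < s) (ha : 0 < a)
    (hat : a < t) (hA : IsMuckenhoupt d (1 + 1 / t) w) (hR : IsReverseHolder d s w) :
    IsMuckenhoupt d (1 + a / s) (fun x => w x ^ (-a)) ∧
      IsReverseHolder d (t / a) (fun x => w x ^ (-a)) := by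
  have hs0 : 0 < s := one_pos.trans hs
  have ht0 : 0 < t := ha.trans hat
  have hdich := hR.ae_eq_zero_or_ae_pos hs
  obtain ⟨hw0, hwi, C₁, hC₁, hA⟩ := hA
  obtain ⟨-, -, C₂, hC₂, hR⟩ := hR
  have hv0 : ∀ x, 0 ≤ w x ^ (-a) := fun x => rpow_nonneg (hw0 x) _
  have hwm : AEMeasurable w := hwi.aestronglyMeasurable.aemeasurable
  have hA_neg : -1 / (1 / t) = -t := by field_simp
  have hs_exp : (fun x => (w x ^ (-a)) ^ (-1 / (a / s))) = fun x => w x ^ s := by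
    funext x
    rw [← rpow_mul (hw0 x)]
    congr 1
    field_simp
  have ht_exp : (fun x => (w x ^ (-a)) ^ (t / a)) = fun x => w x ^ (-t) := by
    funext x
    rw [← rpow_mul (hw0 x)]
    congr 1
    field_simp
  have hA_exp : 1 + 1 / t - 1 = 1 / t := add_sub_cancel_left _ _
  have hA_exp' : 1 + a / s - 1 = a / s := add_sub_cancel_left _ _
  have hR_exp : 1 / (t / a) = a / t := one_div_div _ _
  simp only [IsMuckenhoupt, IsReverseHolder, hs_exp, ht_exp, hA_exp', hR_exp]
  rw [hA_exp, hA_neg] at hA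
  rcases hdich with hz | hpos
  · have hvz : (fun x => w x ^ (-a)) =ᵐ[volume] 0 := hz.mono fun x hx => by
      simp [hx, zero_rpow (neg_ne_zero.2 ha.ne')]
    have hvz' : (fun x => w x ^ (-t)) =ᵐ[volume] 0 := hz.mono fun x hx => by
      simp [hx, zero_rpow (neg_ne_zero.2 ht0.ne')]
    have hvi : LocallyIntegrable (fun x => w x ^ (-a)) :=
      (locallyIntegrable_zero (ε'' := ℝ)).congr hvz.symm
    refine ⟨⟨hv0, hvi, 1, one_pos, fun c r _ => ?_⟩, hv0, hvi, 1, one_pos, fun c r _ => ?_⟩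
    · simp [ballAvg_eq_zero_of_ae_eq_zero hvz]
    · simp [ballAvg_eq_zero_of_ae_eq_zero hvz', ha, ht0]
  have hofReal : ∀ᵐ x, ∀ b : ℝ, ENNReal.ofReal (w x ^ b) = ENNReal.ofReal (w x) ^ b :=
    hpos.mono fun x hx b => (ENNReal.ofReal_rpow_of_pos hx).symm
  have hum : AEMeasurable (fun x => ENNReal.ofReal (w x)) := hwm.ennreal_ofReal
  have havg : ∀ (c : EuclideanSpace ℝ (Fin d)) (r b : ℝ), ballAvg (ball c r) (fun x => w x ^ b) =
      ∫⁻ x, ENNReal.ofReal (w x) ^ b ∂(ProbabilityTheory.cond volume (ball c r)) := fun c r b => by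
    rw [ballAvg_eq_lintegral_cond]
    exact lintegral_congr_ae
      ((cond_ball_absolutelyContinuous c r).ae_le (hofReal.mono fun x hx => hx b))
  have hneg : ∀ (c : EuclideanSpace ℝ (Fin d)) (r : ℝ), 0 < r →
      ballAvg (ball c r) (fun x => w x ^ (-a)) ≤
        ballAvg (ball c r) (fun x => w x ^ (-t)) ^ (a / t) := by
    intro c r hr
    have := isProbabilityMeasure_cond_ball c hr
    rw [havg, havg]
    have hcm := (hum.mono_ac (cond_ball_absolutelyContinuous c r)).pow_const (-t)
    have := lintegral_rpow_le_rpow_lintegral hcm (by positivity) (div_le_one_of_le₀ hat.le ht0.le)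
    simp only [← ENNReal.rpow_mul] at this
    rwa [show -t * (a / t) = -a by field_simp] at this
  have hone : ∀ (c : EuclideanSpace ℝ (Fin d)) (r : ℝ), 0 < r →
      1 ≤ ballAvg (ball c r) (fun x => w x ^ s) ^ (a / s) *
        ballAvg (ball c r) (fun x => w x ^ (-a)) := by
    intro c r hr
    have := isProbabilityMeasure_cond_ball c hr
    have hac := cond_ball_absolutelyContinuous c r
    rw [havg, havg]
    exact one_le_rpow_lintegral_rpow_mul_lintegral_rpow_neg (hum.mono_ac hac)
      (hac.ae_le (hpos.mono fun x hx => by simpa using hx))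
      (.of_forall fun x => ENNReal.ofReal_ne_top) hs0 ha
  have hprod : ∀ (c : EuclideanSpace ℝ (Fin d)) (r : ℝ), 0 < r →
      ballAvg (ball c r) (fun x => w x ^ s) ^ (a / s) *
        ballAvg (ball c r) (fun x => w x ^ (-t)) ^ (a / t) ≤ ENNReal.ofReal ((C₂ * C₁) ^ a) := by
    intro c r hr
    have : ballAvg (ball c r) (fun x => w x ^ s) ^ (1 / s) *
        ballAvg (ball c r) (fun x => w x ^ (-t)) ^ (1 / t) ≤ ENNReal.ofReal (C₂ * C₁) := by
      rw [ENNReal.ofReal_mul hC₂.le]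
      refine (mul_le_mul_left (hR c r hr) _).trans ?_
      rw [mul_assoc]
      exact mul_le_mul_right (hA c r hr) _
    have := ENNReal.rpow_le_rpow this ha.le
    rwa [ENNReal.mul_rpow_of_nonneg _ _ ha.le, ← ENNReal.rpow_mul, ← ENNReal.rpow_mul,
      one_div_mul_eq_div, one_div_mul_eq_div,
      ENNReal.ofReal_rpow_of_nonneg (by positivity) ha.le] at this
  have hvi : LocallyIntegrable (fun x => w x ^ (-a)) := by
    refine locallyIntegrable_of_ballAvg_ne_top (hwm.pow_const _).aestronglyMeasurable hv0
      fun c r hr => ?_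
    have hne : ballAvg (ball c r) w ≠ 0 := by
      have := isProbabilityMeasure_cond_ball c hr
      have hac := cond_ball_absolutelyContinuous c r
      rw [ballAvg_eq_lintegral_cond, Ne, lintegral_eq_zero_iff' (hum.mono_ac hac)]
      intro h0
      obtain ⟨x, hx0, hx⟩ := (h0.and (hac.ae_le hpos)).exists
      exact hx.not_ge (ENNReal.ofReal_eq_zero.1 hx0)
    have hfin : ballAvg (ball c r) (fun x => w x ^ (-t)) ≠ ∞ := by
      intro htop
      have := hA c r hr
      rw [htop, ENNReal.top_rpow_of_pos (by positivity), ENNReal.mul_top hne] at this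
      exact ENNReal.ofReal_ne_top (top_le_iff.1 this)
    exact ne_top_of_le_ne_top (ENNReal.rpow_ne_top_of_nonneg (by positivity) hfin) (hneg c r hr)
  refine ⟨⟨hv0, hvi, (C₂ * C₁) ^ a, by positivity, fun c r hr => ?_⟩,
    hv0, hvi, (C₂ * C₁) ^ a, by positivity, fun c r hr => ?_⟩
  · rw [mul_comm]
    exact (mul_le_mul_right (hneg c r hr) _).trans (hprod c r hr)
  · refine (le_mul_of_one_le_right' (hone c r hr)).trans ?_
    rw [← mul_assoc, mul_comm (_ ^ (a / t))]
    exact mul_le_mul_left (hprod c r hr) _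

end Weights

theorem stmt15 (d : ℕ) (hd : 1 ≤ d) (p₀ p q₀ : ℝ)
    (hp₀ : 1 < p₀) (hp₀p : p₀ < p) (hpq₀ : p < q₀)
    (w : EuclideanSpace ℝ (Fin d) → ℝ) (hw : ∀ x, 0 ≤ w x) :
    (IsMuckenhoupt d (p / p₀) w ∧ IsReverseHolder d (conjExp (q₀ / p)) w) ↔
      (IsMuckenhoupt d (conjExp p / conjExp q₀) (fun x => w x ^ (1 - conjExp p)) ∧
        IsReverseHolder d (conjExp (conjExp p₀ / conjExp p))
          (fun x => w x ^ (1 - conjExp p))) := by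
  have hp1 : 0 < p - 1 := by linarith
  have hp₀1 : 0 < p₀ - 1 := by linarith
  have hq₀1 : 0 < q₀ - 1 := by linarith
  have hpp₀ : 0 < p - p₀ := by linarith
  have hqp : 0 < q₀ - p := by linarith
  have hp₀0 : 0 < p₀ := by linarith
  have hp0 : 0 < p := by linarith
  have hq₀0 : 0 < q₀ := by linarith
  obtain ⟨a, ha⟩ : ∃ a, a = 1 / (p - 1) := ⟨_, rfl⟩
  obtain ⟨s, hs⟩ : ∃ s, s = q₀ / (q₀ - p) := ⟨_, rfl⟩
  obtain ⟨t, ht⟩ : ∃ t, t = p₀ / (p - p₀) := ⟨_, rfl⟩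
  have ha0 : 0 < a := by rw [ha]; positivity
  have hs1 : 1 < s := by rw [hs, one_lt_div hqp]; linarith
  have hat : a < t := by rw [ha, ht, div_lt_div_iff₀ hp1 hpp₀]; nlinarith
  have hs0 : 0 < s := one_pos.trans hs1
  have ht0 : 0 < t := ha0.trans hat
  have e1 : p / p₀ = 1 + 1 / t := by rw [ht]; field_simp; ring
  have e2 : conjExp (q₀ / p) = s := by
    have : q₀ / p - 1 = (q₀ - p) / p := by field_simp
    rw [conjExp, hs, this]; field_simp
  have e3 : conjExp p / conjExp q₀ = 1 + a / s := by
    rw [conjExp, conjExp, ha, hs]; field_simp; ring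
  have e4 : conjExp (conjExp p₀ / conjExp p) = t / a := by
    have : p₀ / (p₀ - 1) / (p / (p - 1)) - 1 = (p - p₀) / ((p₀ - 1) * p) := by
      field_simp; ring
    rw [conjExp, conjExp, conjExp, this, ha, ht]; field_simp
  have e5 : 1 - conjExp p = -a := by rw [conjExp, ha]; field_simp; ring
  rw [e1, e2, e3, e4, e5]
  refine ⟨fun h => h.1.rpow_neg_of_isReverseHolder hs1 ha0 hat h.2, fun h => ?_⟩
  have hw' : (fun x => (w x ^ (-a)) ^ (-(1 / a))) = w := by
    funext x
    rw [← rpow_mul (hw x), neg_mul_neg, mul_one_div_cancel ha0.ne', rpow_one]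
  have key := IsMuckenhoupt.rpow_neg_of_isReverseHolder (s := t / a) (t := s / a) (a := 1 / a)
    ((one_lt_div ha0).2 hat) (by positivity) (div_lt_div_of_pos_right hs1 ha0)
    (by rw [one_div_div]; exact h.1) h.2
  rwa [hw', div_div_div_cancel_right₀ ha0.ne', div_div_div_cancel_right₀ ha0.ne', div_one]
    at key
end

section
/- Let d ≥ 3 be an integer. For 0 < ε < 1 define w_ε(x) = |x|^{ε−1}/(1+|x|^ε)² on ℝ^d. Then there exists a constant C > 0 depending only on d (in particular independent of ε) such that for every ε ∈ (0,1) and every ball B ⊂ ℝ^d, (⨍_B w_ε dx)(⨍_B w_ε^{−1} dx) ≤ C; that is, the weights w_ε belong to the Muckenhoupt class A₂ with A₂-constant uniformly bounded for ε ∈ (0,1). -/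
open MeasureTheory Metric Real
open scoped ENNReal

theorem ballAvg_mono {d : ℕ} {B : Set (EuclideanSpace ℝ (Fin d))} (hB : MeasurableSet B)
    {f g : EuclideanSpace ℝ (Fin d) → ℝ} (h : ∀ x ∈ B, f x ≤ g x) :
    ballAvg B f ≤ ballAvg B g :=
  ENNReal.div_le_div_right
    (setLIntegral_mono' hB fun x hx => ENNReal.ofReal_le_ofReal (h x hx)) _

theorem ballAvg_const_mul {d : ℕ} {B : Set (EuclideanSpace ℝ (Fin d))} {a : ℝ} (ha : 0 ≤ a)
    (f : EuclideanSpace ℝ (Fin d) → ℝ) :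
    ballAvg B (fun x => a * f x) = ENNReal.ofReal a * ballAvg B f := by
  simp only [ballAvg, ENNReal.ofReal_mul ha]
  rw [lintegral_const_mul' _ _ ENNReal.ofReal_ne_top, mul_div_assoc]

theorem ballAvg_const_le {d : ℕ} (B : Set (EuclideanSpace ℝ (Fin d))) (a : ℝ) :
    ballAvg B (fun _ => a) ≤ ENNReal.ofReal a := by
  simp only [ballAvg, lintegral_const, Measure.restrict_apply_univ]
  exact ENNReal.div_le_of_le_mul le_rfl

theorem radialWeight_anti {ε s t : ℝ} (h0 : 0 < ε) (h1 : ε < 1) (hs : 0 < s) (hst : s ≤ t) :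
    t ^ (ε - 1) / (1 + t ^ ε) ^ 2 ≤ s ^ (ε - 1) / (1 + s ^ ε) ^ 2 := by
  have h : s ^ ε ≤ t ^ ε := rpow_le_rpow hs.le hst h0.le
  have hsε : 0 < s ^ ε := rpow_pos_of_pos hs ε
  have hts : t ^ (ε - 1) ≤ s ^ (ε - 1) := rpow_le_rpow_of_nonpos hs hst (by linarith)
  gcongr

theorem radialWeight_le_sq_mul {ε s t : ℝ} (h0 : 0 < ε) (h1 : ε < 1) (hs : 0 < s)
    (hst : s ≤ t) :
    s ^ (ε - 1) / (1 + s ^ ε) ^ 2 ≤ t ^ (ε - 1) / (1 + t ^ ε) ^ 2 * (t / s) ^ 2 := by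
  have ht : 0 < t := hs.trans_le hst
  have hsε : 0 < s ^ ε := rpow_pos_of_pos hs ε
  have htε : 0 < t ^ ε := rpow_pos_of_pos ht ε
  have h : s ^ ε ≤ t ^ ε := rpow_le_rpow hs.le hst h0.le
  have h' : t ^ ε * s ≤ s ^ ε * t := by
    have := rpow_le_rpow hs.le hst (show 0 ≤ 1 - ε by linarith)
    rw [rpow_sub hs, rpow_sub ht, rpow_one, rpow_one, div_le_div_iff₀ hsε htε] at this
    linarith
  have key : s * s ^ ε * (1 + t ^ ε) ^ 2 ≤ t * t ^ ε * (1 + s ^ ε) ^ 2 := by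
    have e : t * t ^ ε * (1 + s ^ ε) ^ 2 - s * s ^ ε * (1 + t ^ ε) ^ 2 =
        (t * t ^ ε - s * s ^ ε) + 2 * (s ^ ε * t ^ ε) * (t - s)
          + (s ^ ε * t ^ ε) * (s ^ ε * t - t ^ ε * s) := by ring
    have h2 : s * s ^ ε ≤ t * t ^ ε := mul_le_mul hst h hsε.le ht.le
    have h3 : 0 ≤ 2 * (s ^ ε * t ^ ε) * (t - s) := mul_nonneg (by positivity) (by linarith)
    have h4 : 0 ≤ (s ^ ε * t ^ ε) * (s ^ ε * t - t ^ ε * s) :=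
      mul_nonneg (by positivity) (by linarith)
    linarith
  rw [rpow_sub_one hs.ne', rpow_sub_one ht.ne', div_div, div_div, div_pow, div_mul_div_comm,
    div_le_div_iff₀ (by positivity) (by positivity)]
  nlinarith [mul_le_mul_of_nonneg_left key (mul_pos hs ht).le]

theorem lintegral_ball_inv_norm_sq_ne_top {d : ℕ} (hd : 3 ≤ d) :
    ∫⁻ x in ball (0 : EuclideanSpace ℝ (Fin d)) 1, ENNReal.ofReal ((1 / ‖x‖) ^ 2) ≠ ∞ := by
  have : Nonempty (Fin d) := ⟨⟨0, by omega⟩⟩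
  have h : IntegrableOn (fun x : EuclideanSpace ℝ (Fin d) => (1 / ‖x‖) ^ 2) (ball 0 1) := by
    rw [integrableOn_fun_norm_addHaar volume (f := fun y : ℝ => (1 / y) ^ 2)]
    have hc : IntegrableOn (fun y : ℝ => y ^ (d - 3)) (Set.Ioo 0 1) :=
      ((continuous_pow (d - 3)).continuousOn.integrableOn_compact
        (isCompact_Icc (a := (0 : ℝ)) (b := 1))).mono_set Set.Ioo_subset_Icc_self
    refine hc.congr_fun (fun y hy => ?_) measurableSet_Ioo
    have hy0 : y ≠ 0 := hy.1.ne'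
    obtain ⟨k, rfl⟩ := Nat.exists_eq_add_of_le hd
    have e1 : 3 + k - 3 = k := by omega
    have e2 : 3 + k - 1 = k + 2 := by omega
    simp only [finrank_euclideanSpace, Fintype.card_fin, e1, e2, smul_eq_mul]
    field_simp
    ring
  exact h.lintegral_lt_top.ne

theorem lintegral_ball_div_norm_sq {d : ℕ} {R : ℝ} (hR : 0 < R) :
    ∫⁻ x in ball (0 : EuclideanSpace ℝ (Fin d)) R, ENNReal.ofReal ((R / ‖x‖) ^ 2) =
      ENNReal.ofReal (R ^ d) *
        ∫⁻ x in ball (0 : EuclideanSpace ℝ (Fin d)) 1, ENNReal.ofReal ((1 / ‖x‖) ^ 2) := by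
  set f : EuclideanSpace ℝ (Fin d) → ℝ≥0∞ :=
    (ball 0 R).indicator fun x => ENNReal.ofReal ((R / ‖x‖) ^ 2) with hf
  have hfm : Measurable f := Measurable.indicator (by fun_prop) measurableSet_ball
  have hmap := lintegral_map (μ := volume) hfm (measurable_const_smul R)
  rw [Measure.map_addHaar_smul volume hR.ne', lintegral_smul_measure] at hmap
  have hcomp : ∀ x, f (R • x) =
      (ball (0 : EuclideanSpace ℝ (Fin d)) 1).indicator
        (fun x => ENNReal.ofReal ((1 / ‖x‖) ^ 2)) x := by
    intro x
    have hm : R • x ∈ ball (0 : EuclideanSpace ℝ (Fin d)) R ↔ x ∈ ball 0 1 := by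
      simp [norm_smul, abs_of_pos hR, hR]
    by_cases hx : x ∈ ball (0 : EuclideanSpace ℝ (Fin d)) 1
    · rw [hf, Set.indicator_of_mem (hm.2 hx), Set.indicator_of_mem hx, norm_smul,
        norm_of_nonneg hR.le, div_mul_eq_div_div, div_self hR.ne']
    · rw [hf, Set.indicator_of_notMem (mt hm.1 hx), Set.indicator_of_notMem hx]
  simp only [hcomp] at hmap
  rw [lintegral_indicator measurableSet_ball, lintegral_indicator measurableSet_ball,
    finrank_euclideanSpace, Fintype.card_fin, abs_of_pos (by positivity), smul_eq_mul] at hmap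
  rw [← hmap, ← mul_assoc, ← ENNReal.ofReal_mul (by positivity),
    mul_inv_cancel₀ (by positivity), ENNReal.ofReal_one, one_mul]

theorem exists_ballAvg_div_norm_sq_le {d : ℕ} (hd : 3 ≤ d) :
    ∃ C : ℝ, 0 < C ∧ ∀ (c : EuclideanSpace ℝ (Fin d)) (r : ℝ), 0 < r →
      ballAvg (ball c r) (fun x => ((‖c‖ + r) / ‖x‖) ^ 2) ≤ ENNReal.ofReal C := by
  set K := ∫⁻ x in ball (0 : EuclideanSpace ℝ (Fin d)) 1, ENNReal.ofReal ((1 / ‖x‖) ^ 2) with hK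
  set V := volume (ball (0 : EuclideanSpace ℝ (Fin d)) 1)
  have hV0 : V ≠ 0 := (measure_ball_pos _ _ one_pos).ne'
  have hfin : ENNReal.ofReal (3 ^ d) * K / V ≠ ∞ :=
    ENNReal.div_ne_top
      (ENNReal.mul_ne_top ENNReal.ofReal_ne_top (lintegral_ball_inv_norm_sq_ne_top hd)) hV0
  refine ⟨9 + (ENNReal.ofReal (3 ^ d) * K / V).toReal, by positivity, fun c r hr => ?_⟩
  have hR : 0 < ‖c‖ + r := by positivity
  rcases le_total (2 * r) ‖c‖ with hcr | hcr
  · calc ballAvg (ball c r) (fun x => ((‖c‖ + r) / ‖x‖) ^ 2)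
        ≤ ballAvg (ball c r) (fun _ => 9) := ballAvg_mono measurableSet_ball fun x hx => by
          have h1 : ‖c‖ - ‖x‖ < r :=
            (norm_sub_norm_le c x).trans_lt (by rwa [← dist_eq_norm, dist_comm])
          have h2 : (‖c‖ + r) / ‖x‖ ≤ 3 := by
            rw [div_le_iff₀ (by linarith)]
            linarith
          have h3 : 0 ≤ (‖c‖ + r) / ‖x‖ := by positivity
          nlinarith
      _ ≤ ENNReal.ofReal 9 := ballAvg_const_le _ _
      _ ≤ _ := ENNReal.ofReal_le_ofReal (le_add_of_nonneg_right ENNReal.toReal_nonneg)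
  · have hsub : ball c r ⊆ ball 0 (‖c‖ + r) := ball_subset_ball' (by simp [add_comm])
    have hrd : ENNReal.ofReal (r ^ d) ≠ 0 := by simpa using pow_pos hr d
    calc ballAvg (ball c r) (fun x => ((‖c‖ + r) / ‖x‖) ^ 2)
        ≤ (ENNReal.ofReal ((‖c‖ + r) ^ d) * K) / (ENNReal.ofReal (r ^ d) * V) := by
          rw [ballAvg, Measure.addHaar_ball_of_pos volume c hr, finrank_euclideanSpace,
            Fintype.card_fin, hK, ← lintegral_ball_div_norm_sq hR]
          exact ENNReal.div_le_div_right (lintegral_mono_set hsub) _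
      _ ≤ (ENNReal.ofReal (r ^ d) * (ENNReal.ofReal (3 ^ d) * K)) /
            (ENNReal.ofReal (r ^ d) * V) := by
          rw [← mul_assoc, ← ENNReal.ofReal_mul (by positivity), ← mul_pow]
          gcongr
          linarith
      _ = ENNReal.ofReal (3 ^ d) * K / V :=
          ENNReal.mul_div_mul_left _ _ hrd ENNReal.ofReal_ne_top
      _ = ENNReal.ofReal (ENNReal.ofReal (3 ^ d) * K / V).toReal :=
          (ENNReal.ofReal_toReal hfin).symm
      _ ≤ _ := ENNReal.ofReal_le_ofReal (by linarith)

theorem stmt19 (d : ℕ) (hd : 3 ≤ d) :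
    ∃ C : ℝ, 0 < C ∧ ∀ ε : ℝ, 0 < ε → ε < 1 →
      ∀ (c : EuclideanSpace ℝ (Fin d)) (r : ℝ), 0 < r →
        ballAvg (Metric.ball c r)
            (fun x => ‖x‖ ^ (ε - 1) / (1 + ‖x‖ ^ ε) ^ 2) *
          ballAvg (Metric.ball c r)
            (fun x => (‖x‖ ^ (ε - 1) / (1 + ‖x‖ ^ ε) ^ 2)⁻¹) ≤
        ENNReal.ofReal C := by
  obtain ⟨C, hC, hle⟩ := exists_ballAvg_div_norm_sq_le hd
  refine ⟨C, hC, fun ε h0 h1 c r hr => ?_⟩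
  set R := ‖c‖ + r with hRdef
  have hR : 0 < R := by positivity
  set a := R ^ (ε - 1) / (1 + R ^ ε) ^ 2
  have ha : 0 < a := by positivity
  have hxR : ∀ x ∈ ball c r, ‖x‖ ≤ R := fun x hx => by
    have h : ‖x‖ - ‖c‖ < r := (norm_sub_norm_le x c).trans_lt (by rwa [← dist_eq_norm])
    linarith
  have hw : ballAvg (ball c r) (fun x => ‖x‖ ^ (ε - 1) / (1 + ‖x‖ ^ ε) ^ 2) ≤
      ENNReal.ofReal a * ballAvg (ball c r) (fun x => (R / ‖x‖) ^ 2) := by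
    rw [← ballAvg_const_mul ha.le]
    refine ballAvg_mono measurableSet_ball fun x hx => ?_
    rcases (norm_nonneg x).eq_or_lt with h | h
    · simp [← h, zero_rpow (show ε - 1 ≠ 0 by linarith)]
    · exact radialWeight_le_sq_mul h0 h1 h (hxR x hx)
  have hw' : ballAvg (ball c r) (fun x => (‖x‖ ^ (ε - 1) / (1 + ‖x‖ ^ ε) ^ 2)⁻¹) ≤
      ENNReal.ofReal a⁻¹ := by
    refine (ballAvg_mono measurableSet_ball fun x hx => ?_).trans (ballAvg_const_le _ a⁻¹)
    rcases (norm_nonneg x).eq_or_lt with h | h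
    · simpa [← h, zero_rpow (show ε - 1 ≠ 0 by linarith)] using ha.le
    · exact inv_anti₀ ha (radialWeight_anti h0 h1 h (hxR x hx))
  calc _ ≤ ENNReal.ofReal a * ballAvg (ball c r) (fun x => (R / ‖x‖) ^ 2) *
        ENNReal.ofReal a⁻¹ := mul_le_mul' hw hw'
    _ = ballAvg (ball c r) (fun x => (R / ‖x‖) ^ 2) := by
        rw [mul_right_comm, ← ENNReal.ofReal_mul ha.le, mul_inv_cancel₀ ha.ne',
          ENNReal.ofReal_one, one_mul]
    _ ≤ ENNReal.ofReal C := hle c r hr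
end
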